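/- Let q be a prime power, ψ : 𝔽_q → ℂ a nontrivial additive character, β a composition of N with ℓ parts, and P a normal subposet of the chain on {1,…,ℓ}. Let λ, μ ∈ T_P^β, and let Λ and M be partial permutation matrices in 𝔲𝔱_{fat_β(P)} with block-rank vectors λ and μ respectively. For i P j set r_{ij} = β_i − Σ_{k < j} μ(i,k) − Σ_{m > j} λ(i,m) and c_{ij} = β_j − Σ_{k > i} μ(k,j) − Σ_{h < i} λ(h,j) (all sums over pairs in the domain of λ, μ; values off the domain are 0), and assume r_{ij} ≥ 0 and c_{ij} ≥ 0 for all i P j. Then χ^Λ(1 + M) = q^{dim_L(λ) + dim_R(λ) − nst^λ_μ − crs(λ)} · ∏_{(i,j) : i P j} S(r_{ij}, c_{ij}, λ(i,j), μ(i,j)), where S(m, n, l, j) := Σ_{a=0}^{l} (−1)^a q^{(l−a)j + a(a−1)/2} [j choose a]_q · N_q(m−j, n−j, l−a). -/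

import Mathlib

open scoped Classical

noncomputable section

/-- A subposet of the chain `0 < 1 < ⋯ < l-1`: a transitive relation contained in `<`. -/
def IsChainSubposet {l : ℕ} (P : Fin l → Fin l → Prop) : Prop :=
  (∀ i j k, P i j → P j k → P i k) ∧ ∀ i j, P i j → i < j

/-- A normal subposet of the chain. -/
def IsNormalChainSubposet {l : ℕ} (P : Fin l → Fin l → Prop) : Prop :=
  IsChainSubposet P ∧ (∀ i j k, P j k → i < j → P i k) ∧ ∀ j k m, P j k → k < m → P j m

/-- The relation `fat_β(P)` on `Fin N` obtained from a relation `P` on block indices. -/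
def fatR {N l : ℕ} (blk : Fin N → Fin l) (P : Fin l → Fin l → Prop) :
    Fin N → Fin N → Prop := fun r s => P (blk r) (blk s)

/-- The "pattern group" of a relation: unipotent matrices supported on the relation. -/
def UTgrp (F : Type) [Field F] {N : ℕ} (R : Fin N → Fin N → Prop) :
    Set (Matrix (Fin N) (Fin N) F) :=
  {g | (∀ r, g r r = 1) ∧ ∀ r s, r ≠ s → ¬ R r s → g r s = 0}

/-- The nilpotent "pattern algebra" of a relation. -/
def utAlg (F : Type) [Field F] {N : ℕ} (R : Fin N → Fin N → Prop) :
    Set (Matrix (Fin N) (Fin N) F) :=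
  {x | ∀ r s, ¬ R r s → x r s = 0}

/-- The parabolic subgroup `P_β`: invertible block upper-triangular matrices. -/
def parab (F : Type) [Field F] {N l : ℕ} (blk : Fin N → Fin l) :
    Set (Matrix (Fin N) (Fin N) F) :=
  {g | IsUnit g ∧ ∀ r s, ¬ blk r ≤ blk s → g r s = 0}

/-- The Levi subgroup `L_β`: invertible block diagonal matrices. -/
def levi (F : Type) [Field F] {N l : ℕ} (blk : Fin N → Fin l) :
    Set (Matrix (Fin N) (Fin N) F) :=
  {g | IsUnit g ∧ ∀ r s, blk r ≠ blk s → g r s = 0}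

/-- The opposite unipotent radical `U⁻_β`: block lower uni-triangular matrices. -/
def uminus (F : Type) [Field F] {N l : ℕ} (blk : Fin N → Fin l) :
    Set (Matrix (Fin N) (Fin N) F) :=
  {g | (∀ r, g r r = 1) ∧ ∀ r s, r ≠ s → ¬ blk s < blk r → g r s = 0}

/-- Truncation of a matrix to the positions of a relation. -/
def trunc {F : Type} [Field F] {N : ℕ} (R : Fin N → Fin N → Prop)
    (x : Matrix (Fin N) (Fin N) F) : Matrix (Fin N) (Fin N) F :=
  fun r s => if R r s then x r s else 0

/-- The two-sided orbit `O(Y)` of `Y` under the block lower-triangular invertible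
matrices, truncated back to the positions of `R`. -/
def orb (F : Type) [Field F] {N l : ℕ} (blk : Fin N → Fin l) (R : Fin N → Fin N → Prop)
    (Y : Matrix (Fin N) (Fin N) F) : Set (Matrix (Fin N) (Fin N) F) :=
  {Z | ∃ g h : Matrix (Fin N) (Fin N) F, IsUnit g ∧ IsUnit h ∧
      (∀ r s, blk r < blk s → g r s = 0) ∧ (∀ r s, blk r < blk s → h r s = 0) ∧
      Z = trunc R (g * Y * h)}

/-- The supercharacter `χ^Y` as a function on matrices. -/
def chi {F : Type} [Field F] [Fintype F] (ψ : F → ℂ) {N l : ℕ} (blk : Fin N → Fin l)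
    (R : Fin N → Fin N → Prop) (Y u : Matrix (Fin N) (Fin N) F) : ℂ :=
  ∑ᶠ Z ∈ orb F blk R Y, ψ (∑ r, ∑ s, Z r s * (u - 1) r s)

/-- A partial permutation matrix: 0-1 entries, at most one 1 in each row and column. -/
def IsPPM {F : Type} [Field F] {N : ℕ} (x : Matrix (Fin N) (Fin N) F) : Prop :=
  (∀ r s, x r s = 0 ∨ x r s = 1) ∧
  (∀ r s t, x r s ≠ 0 → x r t ≠ 0 → s = t) ∧
  (∀ r s t, x r t ≠ 0 → x s t ≠ 0 → r = s)

/-- The rank of the block of `x` with rows in block `i` and columns in block `j`. -/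
def blockRank {F : Type} [Field F] {N l : ℕ} (blk : Fin N → Fin l)
    (x : Matrix (Fin N) (Fin N) F) (i j : Fin l) : ℕ :=
  (x.submatrix (fun r : {r : Fin N // blk r = i} => (r : Fin N))
    (fun s : {s : Fin N // blk s = j} => (s : Fin N))).rank

end

noncomputable section

/-- `N_q(m,n,r)`: the number of `m × n` matrices over the finite field `F` of rank `r`. -/
def NqF (F : Type) [Field F] [Fintype F] (m n r : ℕ) : ℕ :=
  Nat.card {A : Matrix (Fin m) (Fin n) F // A.rank = r}

/-- The single-block supercharacter value
`S(m,n,l,j) = Σ_{a=0}^{l} (−1)^a q^{(l−a)j + a(a−1)/2} [j choose a]_q N_q(m−j,n−j,l−a)`. -/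
def Sval (F : Type) [Field F] [Fintype F] (G : ℕ → ℕ → ℕ) (m n lv jv : ℕ) : ℂ :=
  ∑ a ∈ Finset.range (lv + 1),
    (-1 : ℂ) ^ a * (Fintype.card F : ℂ) ^ ((lv - a) * jv + a * (a - 1) / 2) *
      (G jv a : ℂ) * (NqF F (m - jv) (n - jv) (lv - a) : ℂ)

/-- `λ ∈ T_P^β`: `λ` is supported on `P` and has row and column sums bounded by `β`. -/
def Tmem {l : ℕ} (P : Fin l → Fin l → Prop) (β : Fin l → ℕ)
    (lam : Fin l → Fin l → ℕ) : Prop :=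
  (∀ i j, ¬ P i j → lam i j = 0) ∧
  ∀ j, (∑ i ∈ Finset.univ.filter (fun i => P i j), lam i j) ≤ β j ∧
    (∑ k ∈ Finset.univ.filter (fun k => P j k), lam j k) ≤ β j

/-- `dim_L(λ) = Σ_{i P j, j < k, i P k} λ(i,k)·β_j`. -/
def bDimL {l : ℕ} (P : Fin l → Fin l → Prop) (β : Fin l → ℕ)
    (lam : Fin l → Fin l → ℕ) : ℕ :=
  ∑ t ∈ Finset.univ.filter (fun t : Fin l × Fin l × Fin l =>
      P t.1 t.2.1 ∧ t.2.1 < t.2.2 ∧ P t.1 t.2.2),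
    lam t.1 t.2.2 * β t.2.1

/-- `dim_R(λ) = Σ_{i < j, j P k, i P k} λ(i,k)·β_j`. -/
def bDimR {l : ℕ} (P : Fin l → Fin l → Prop) (β : Fin l → ℕ)
    (lam : Fin l → Fin l → ℕ) : ℕ :=
  ∑ t ∈ Finset.univ.filter (fun t : Fin l × Fin l × Fin l =>
      t.1 < t.2.1 ∧ P t.2.1 t.2.2 ∧ P t.1 t.2.2),
    lam t.1 t.2.2 * β t.2.1

/-- `crs(λ) = Σ_{i < j, j P k, k < l, i P k, j P l} λ(i,k)·λ(j,l)`. -/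
def bCrs {l : ℕ} (P : Fin l → Fin l → Prop) (lam : Fin l → Fin l → ℕ) : ℕ :=
  ∑ t ∈ Finset.univ.filter (fun t : Fin l × Fin l × Fin l × Fin l =>
      t.1 < t.2.1 ∧ P t.2.1 t.2.2.1 ∧ t.2.2.1 < t.2.2.2 ∧
      P t.1 t.2.2.1 ∧ P t.2.1 t.2.2.2),
    lam t.1 t.2.2.1 * lam t.2.1 t.2.2.2

/-- `nst^λ_μ = Σ_{i < j, k < l, i P l, j P k} λ(i,l)·μ(j,k)`. -/
def bNst {l : ℕ} (P : Fin l → Fin l → Prop) (lam mu : Fin l → Fin l → ℕ) : ℕ :=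
  ∑ t ∈ Finset.univ.filter (fun t : Fin l × Fin l × Fin l × Fin l =>
      t.1 < t.2.1 ∧ t.2.2.1 < t.2.2.2 ∧ P t.1 t.2.2.2 ∧ P t.2.1 t.2.2.1),
    lam t.1 t.2.2.2 * mu t.2.1 t.2.2.1

/-- `r_{ij} = β_i − Σ_{k<j} μ(i,k) − Σ_{m>j} λ(i,m)`. -/
def locR {l : ℕ} (β : Fin l → ℕ) (lam mu : Fin l → Fin l → ℕ) (i j : Fin l) : ℤ :=
  (β i : ℤ) - ∑ k ∈ Finset.univ.filter (fun k => k < j), (mu i k : ℤ)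
    - ∑ m ∈ Finset.univ.filter (fun m => j < m), (lam i m : ℤ)

/-- `c_{ij} = β_j − Σ_{k>i} μ(k,j) − Σ_{h<i} λ(h,j)`. -/
def locC {l : ℕ} (β : Fin l → ℕ) (lam mu : Fin l → Fin l → ℕ) (i j : Fin l) : ℤ :=
  (β j : ℤ) - ∑ k ∈ Finset.univ.filter (fun k => i < k), (mu k j : ℤ)
    - ∑ h ∈ Finset.univ.filter (fun h => h < i), (lam h j : ℤ)


def Nr (q : ℂ) : ℕ → ℕ → ℤ → ℂ
  | 0, _, l => if l = 0 then 1 else 0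
  | r+1, c, l => Nr q r c l + (q^c - 1) * q^r * Nr q r (c-1) (l-1)

section cnt
open Module Submodule
def fr {F W : Type} [Field F] [AddCommGroup W] [Module F W] (S : Submodule F W) : ℕ := finrank F S

variable {F : Type} [Field F] [Fintype F] {W : Type} [AddCommGroup W] [Module F W] [Fintype W]

lemma finrank_sup_sing (S : Submodule F W) (v : W) (hv : v ∉ S) :
    finrank F ↥(S ⊔ span F {v}) = finrank F S + 1 := by
  have hv0 : v ≠ 0 := by rintro rfl; exact hv S.zero_mem
  have h := finrank_sup_add_finrank_inf_eq S (span F {v})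
  have hd : S ⊓ span F {v} = ⊥ := by
    rw [← disjoint_iff, disjoint_span_singleton' hv0]; exact hv
  rw [hd, finrank_bot, finrank_span_singleton hv0] at h
  omega

lemma card_coset (K S : Submodule F W) (C : W) (hC : C ∈ S ⊔ K) (c : ℕ)
    (hc : c + finrank F S = finrank F ↥(S ⊔ K)) :
    ((Finset.univ.filter fun x : K => (x : W) + C ∈ S).card : ℂ) * (Fintype.card F : ℂ)^c
      = (Fintype.card F : ℂ)^(finrank F K) := by
  obtain ⟨σ, hσ, κ, hκ, rfl⟩ := mem_sup.1 hC
  have h1 : (Finset.univ.filter fun x : K => (x : W) + (σ + κ) ∈ S).card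
      = Fintype.card ↥(S ⊓ K) := by
    rw [← Fintype.card_subtype]
    refine Fintype.card_congr ⟨fun x => ⟨(x.1 : W) + κ, ?_, K.add_mem x.1.2 hκ⟩,
      fun y => ⟨⟨(y : W) - κ, K.sub_mem y.2.2 hκ⟩, ?_⟩, ?_, ?_⟩
    · have := S.sub_mem x.2 hσ
      have e : (x.1 : W) + κ = (x.1 : W) + (σ + κ) - σ := by abel
      rw [SetLike.mem_coe, e]; exact this
    · have := S.add_mem y.2.1 hσ
      have e : (y : W) - κ + (σ + κ) = y + σ := by abel
      simp only
      rw [e]; exact this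
    · intro x; ext; simp
    · intro x; ext; simp
  rw [h1, Module.card_eq_pow_finrank (K := F)]
  have h := finrank_sup_add_finrank_inf_eq S K
  push_cast
  rw [← pow_add]
  congr 1
  omega

lemma count_main (K : Submodule F W) : ∀ (b : ℕ) (S : Submodule F W) (C : Fin b → W) (R : ℤ) (r c : ℕ),
    r + fr (S ⊔ K ⊔ span F (Set.range C)) = b + fr (S ⊔ K) →
    c + fr S = fr (S ⊔ K) →
    (∑ X : Fin b → K, (if (fr (S ⊔ span F (Set.range fun k => (X k : W) + C k)) : ℤ) = R
      then (1:ℂ) else 0)) * (Fintype.card F : ℂ)^(r*c) =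
     (Fintype.card F : ℂ)^(b * fr K) * Nr (Fintype.card F) r c
      (R - (fr S + (fr (S ⊔ K ⊔ span F (Set.range C)) - fr (S ⊔ K) : ℤ))) := by
  intro b
  have hq : (Fintype.card F : ℂ) ≠ 0 := by simp
  induction b with
  | zero =>
    intro S C R r c hr hc
    have e1 : Set.range C = ∅ := Set.range_eq_empty _
    simp only [e1, span_empty, sup_bot_eq] at hr ⊢
    have : r = 0 := by omega
    subst this
    simp [Nr, sub_eq_zero, eq_comm]
  | succ b ih =>
    intro S C R r c hr hc
    set q : ℂ := (Fintype.card F : ℂ) with hqd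
    have split : ∀ (f : (Fin (b+1) → K) → ℂ), ∑ X, f X = ∑ x : K, ∑ X : Fin b → K, f (Fin.cons x X) := by
      intro f
      rw [← (Fin.consEquiv (fun _ => K)).sum_comp, Fintype.sum_prod_type]
      rfl
    have hrange : ∀ (x : K) (X : Fin b → K),
        S ⊔ span F (Set.range fun k => ((Fin.cons x X : Fin (b+1) → K) k : W) + C k)
        = (S ⊔ span F {(x:W) + C 0}) ⊔ span F (Set.range fun k => (X k : W) + C k.succ) := by
      intro x X
      rw [Fin.range_fin_succ, span_insert, sup_assoc]
      rfl
    have hC : Set.range C = insert (C 0) (Set.range fun k : Fin b => C k.succ) := Fin.range_fin_succ C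
    rw [split]
    simp only [hrange]
    by_cases h0 : C 0 ∈ S ⊔ K
    · have hK' : ∀ x : K, S ⊔ span F {(x:W) + C 0} ⊔ K = S ⊔ K := by
        intro x
        apply le_antisymm
        · refine sup_le (sup_le le_sup_left ?_) le_sup_right
          rw [span_singleton_le_iff_mem]
          exact add_mem (mem_sup_right x.2) h0
        · exact sup_le (le_sup_left.trans le_sup_left) le_sup_right
      have hD : S ⊔ K ⊔ span F (Set.range C) = S ⊔ K ⊔ span F (Set.range fun k : Fin b => C k.succ) := by
        rw [hC, span_insert, ← sup_assoc]
        congr 1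
        rw [sup_eq_left, span_singleton_le_iff_mem]; exact h0
      rw [hD] at hr ⊢
      have hle : fr (S ⊔ K ⊔ span F (Set.range fun k : Fin b => C k.succ)) ≤ b + fr (S ⊔ K) := by
        have h1 : fr _ ≤ fr _ + fr _ := finrank_add_le_finrank_add_finrank (S ⊔ K) (span F (Set.range fun k : Fin b => C k.succ))
        have h2 := finrank_range_le_card (R := F) (fun k : Fin b => C k.succ)
        rw [Set.finrank, Fintype.card_fin] at h2
        change fr _ ≤ b at h2
        omega
      obtain ⟨r, rfl⟩ : ∃ r', r = r' + 1 := ⟨r - 1, by omega⟩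
      have hin : ∀ x : K, (x:W) + C 0 ∈ S → S ⊔ span F {(x:W) + C 0} = S := by
        intro x hx
        rw [sup_eq_left, span_singleton_le_iff_mem]; exact hx
      set f : K → ℂ := fun x => ∑ X : Fin b → K, (if (fr (S ⊔ span F {(x:W) + C 0} ⊔ span F (Set.range fun k => (X k : W) + C k.succ)) : ℤ) = R
      then (1:ℂ) else 0) with hf
      set Dv : ℕ := fr (S ⊔ K ⊔ span F (Set.range fun k : Fin b => C k.succ)) with hDv
      have fin : ∀ x : K, (x:W) + C 0 ∈ S → f x * q^(r*c) = q^(b * fr K) * Nr q r c (R - (fr S + (Dv - fr (S ⊔ K) : ℤ))) := by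
        intro x hx
        have := ih S (fun k => C k.succ) R r c (by omega) hc
        simp only [hf]
        rw [hin x hx, this]
      have fout : ∀ x : K, (x:W) + C 0 ∉ S → f x * q^(r*(c-1)) = q^(b * fr K) * Nr q r (c-1) (R - (fr S + (Dv - fr (S ⊔ K) : ℤ)) - 1) ∧ 1 ≤ c := by
        intro x hx
        have h1 : fr _ = fr _ + 1 := finrank_sup_sing S _ hx
        have h2 : fr (S ⊔ span F {(x:W) + C 0}) ≤ fr (S ⊔ K) := by
          rw [← hK' x]
          exact finrank_mono le_sup_left
        have := ih (S ⊔ span F {(x:W) + C 0}) (fun k => C k.succ) R r (c-1) (by rw [hK']; omega) (by rw [hK']; omega)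
        simp only [hf]
        rw [this, hK', h1]
        refine ⟨?_, by omega⟩
        congr 2
        push_cast
        ring
      have hcard : _ * _ = q ^ (fr K) := card_coset K S (C 0) h0 c hc
      have hsum : ∑ x : K, f x = ∑ x ∈ Finset.univ.filter (fun x : K => (x:W) + C 0 ∈ S), f x + ∑ x ∈ Finset.univ.filter (fun x : K => ¬ (x:W) + C 0 ∈ S), f x :=
        (Finset.sum_filter_add_sum_filter_not _ _ _).symm
      have hcard2 : ((Finset.univ.filter fun x : K => ¬ (x : W) + C 0 ∈ S).card : ℂ)
        + ((Finset.univ.filter fun x : K => (x : W) + C 0 ∈ S).card : ℂ) = q^(fr K) := by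
        rw [← Nat.cast_add, add_comm, Finset.card_filter_add_card_filter_not, Finset.card_univ,
          Module.card_eq_pow_finrank (K := F), ← fr.eq_1 K]
        push_cast; rfl
      set a : ℂ := ((Finset.univ.filter fun x : K => (x : W) + C 0 ∈ S).card : ℂ) with ha
      set L := (R - (fr S + (Dv - fr (S ⊔ K) : ℤ))) with hL
      have s1 : (∑ x ∈ Finset.univ.filter (fun x : K => (x:W) + C 0 ∈ S), f x) * q^(r*c) = a * (q^(b * fr K) * Nr q r c L) := by
        rw [Finset.sum_mul, Finset.sum_congr rfl (fun x hx => fin x (Finset.mem_filter.1 hx).2), Finset.sum_const, nsmul_eq_mul]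
      have s2 : (∑ x ∈ Finset.univ.filter (fun x : K => ¬ (x:W) + C 0 ∈ S), f x) * q^(r*(c-1)) = (q^(fr K) - a) * (q^(b * fr K) * Nr q r (c-1) (L-1)) := by
        rw [Finset.sum_mul, Finset.sum_congr rfl (fun x hx => (fout x (Finset.mem_filter.1 hx).2).1), Finset.sum_const, nsmul_eq_mul]
        congr 1
        rw [← hcard2]; ring
      rw [hsum, Nr]
      rcases Nat.eq_zero_or_pos c with h | h
      · subst h
        have : (Finset.univ.filter fun x : K => ¬ (x : W) + C 0 ∈ S) = ∅ := by
          apply Finset.filter_eq_empty_iff.2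
          intro x _ hx
          have := (fout x hx).2
          omega
        rw [this]
        simp only [Finset.sum_empty, add_zero, pow_zero, sub_self, zero_mul, mul_zero, mul_one] at s1 hcard ⊢
        rw [s1, hcard]; ring
      · obtain ⟨c, rfl⟩ : ∃ c', c = c' + 1 := ⟨c - 1, by omega⟩
        rw [Nat.add_sub_cancel] at s2 ⊢
        rw [← hqd] at hcard
        linear_combination q^(c+1)*s1 + q^r*q^(c+1)*s2 + (q^(b * fr K) * Nr q r (c+1) L) * hcard -  q^r *(q^(b * fr K) * Nr q r c (L-1))* hcard
    · have hnot : ∀ x : K, (x:W) + C 0 ∉ S ⊔ K := by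
        intro x hx
        exact h0 (by simpa using sub_mem hx (mem_sup_right x.2))
      have hK' : ∀ x : K, S ⊔ span F {(x:W) + C 0} ⊔ K = S ⊔ K ⊔ span F {C 0} := by
        intro x
        apply le_antisymm
        · refine sup_le (sup_le (le_sup_left.trans le_sup_left) ?_) (le_sup_right.trans le_sup_left)
          rw [span_singleton_le_iff_mem]
          exact add_mem (mem_sup_left (mem_sup_right x.2)) (mem_sup_right (mem_span_singleton_self _))
        · refine sup_le (sup_le (le_sup_left.trans le_sup_left) le_sup_right) ?_
          rw [span_singleton_le_iff_mem]
          have : C 0 = ((x:W) + C 0) - x := by abel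
          have h1 : (x:W) + C 0 ∈ S ⊔ span F {(x:W) + C 0} ⊔ K := mem_sup_left (mem_sup_right (mem_span_singleton_self _))
          have h2 : (x:W) ∈ S ⊔ span F {(x:W) + C 0} ⊔ K := mem_sup_right x.2
          have h' := sub_mem h1 h2
          rwa [← this] at h'
      have hD : S ⊔ K ⊔ span F (Set.range C) = S ⊔ K ⊔ span F {C 0} ⊔ span F (Set.range fun k : Fin b => C k.succ) := by
        rw [hC, span_insert, ← sup_assoc]
      have hT : fr _ = fr _ + 1 := finrank_sup_sing _ _ h0
      rw [hD] at hr ⊢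
      have key : ∀ x : K, (∑ X : Fin b → K, (if (fr (S ⊔ span F {(x:W) + C 0} ⊔ span F (Set.range fun k => (X k : W) + C k.succ)) : ℤ) = R
      then (1:ℂ) else 0)) * q^(r*c) = q^(b * fr K) * Nr q r c
        (R - (fr S + (fr (S ⊔ K ⊔ span F {C 0} ⊔ span F (Set.range fun k : Fin b => C k.succ)) - fr (S ⊔ K) : ℤ))) := by
        intro x
        have h1 : fr _ = fr _ + 1 := finrank_sup_sing S _ (fun h => hnot x (mem_sup_left h))
        have := ih (S ⊔ span F {(x:W) + C 0}) (fun k => C k.succ) R r c (by rw [hK', hT]; omega) (by rw [hK', hT, h1]; omega)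
        rw [this, hK', h1, hT]
        congr 2
        push_cast
        ring
      rw [Finset.sum_mul, Finset.sum_congr rfl (fun x _ => key x), Finset.sum_const, Finset.card_univ,
          Module.card_eq_pow_finrank (K := F), ← fr.eq_1 K, nsmul_eq_mul]
      push_cast
      rw [← hqd]
      ring

end cnt

section tvsec
open Module Submodule
variable (F : Type) [Field F] [Fintype F]

lemma NqF_eq (m n l : ℕ) : (NqF F m n l : ℂ) = Nr (Fintype.card F) m n l := by
  have hq : (Fintype.card F : ℂ) ≠ 0 := by simp
  have htop : fr (⊤ : Submodule F (Fin n → F)) = n := by simp [fr]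
  have hbot : fr (⊥ : Submodule F (Fin n → F)) = 0 := by simp [fr]
  have hC : span F (Set.range (0 : Fin m → (Fin n → F))) ≤ ⊤ := le_top
  have e1 : (⊥ : Submodule F (Fin n → F)) ⊔ ⊤ ⊔ span F (Set.range (0 : Fin m → (Fin n → F))) = ⊤ := by simp
  have e2 : (⊥ : Submodule F (Fin n → F)) ⊔ ⊤ = ⊤ := by simp
  have h := count_main (F := F) (⊤ : Submodule F (Fin n → F)) m ⊥ 0 l m n (by rw [e1, e2])
    (by rw [e2]; exact (by rw [htop, hbot]; rfl : n + fr (⊥ : Submodule F (Fin n → F)) = fr (⊤ : Submodule F (Fin n → F))))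
  rw [e1, e2, htop, hbot] at h
  have h2 : (∑ X : Fin m → (⊤ : Submodule F (Fin n → F)), (if (fr (⊥ ⊔ span F (Set.range fun k => (X k : Fin n → F) + (0 : Fin m → (Fin n → F)) k)) : ℤ) = l
      then (1:ℂ) else 0)) = (NqF F m n l : ℂ) := by
    rw [NqF, Nat.card_eq_fintype_card, Fintype.card_subtype, Finset.sum_boole]
    congr 1
    refine Finset.card_bij (fun X _ => Matrix.of fun k => (X k : Fin n → F)) ?_ ?_ ?_
    · intro X hX
      simp only [Finset.mem_filter, Finset.mem_univ, true_and] at hX ⊢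
      rw [Matrix.rank_eq_finrank_span_row]
      have : fr (⊥ ⊔ span F (Set.range fun k => (X k : Fin n → F) + (0 : Fin m → (Fin n → F)) k)) = l := by exact_mod_cast hX
      rw [bot_sup_eq] at this
      have e : (fun k => (X k : Fin n → F) + (0 : Fin m → (Fin n → F)) k) = fun k => (X k : Fin n → F) := by
        funext k; simp
      rw [e] at this
      rw [← this, fr]
      rfl
    · intro X _ Y _ h
      funext k
      exact Subtype.ext (congrFun h k)
    · intro A hA
      simp only [Finset.mem_filter, Finset.mem_univ, true_and] at hA
      refine ⟨fun k => ⟨A k, mem_top⟩, ?_, rfl⟩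
      simp only [Finset.mem_filter, Finset.mem_univ, true_and]
      have e : (fun k => A k + (0 : Fin m → (Fin n → F)) k) = fun k => A k := by
        funext k; simp
      rw [bot_sup_eq, ← hA, Matrix.rank_eq_finrank_span_row, fr, e]
      rfl
  rw [h2] at h
  have h3 : (m*n) = m * n := rfl
  have := mul_right_cancel₀ (pow_ne_zero (m*n) hq) (h.trans (mul_comm _ _))
  rw [this]; simp

lemma Nr_neg (q : ℂ) : ∀ (r c : ℕ) (l : ℤ), l < 0 → Nr q r c l = 0 := by
  intro r
  induction r with
  | zero => intro c l h; rw [Nr, if_neg (by omega)]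
  | succ r ih => intro c l h; rw [Nr, ih _ _ h, ih _ _ (by omega)]; simp

def Tv (q : ℂ) (m n : ℕ) : ℕ → ℤ → ℂ
  | 0, l => Nr q m n l
  | j+1, l => q^l * Tv q m n j l - q^(l-1) * Tv q m n j (l-1)

lemma Tv_neg (q : ℂ) (m n : ℕ) : ∀ (j : ℕ) (l : ℤ), l < 0 → Tv q m n j l = 0 := by
  intro j
  induction j with
  | zero => intro l h; exact Nr_neg q m n l h
  | succ j ih => intro l h; rw [Tv, ih _ h, ih _ (by omega)]; simp

lemma qpascal (q : ℕ) (hq : 2 ≤ q) (G : ℕ → ℕ → ℕ)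
    (hG1 : ∀ a k, k ≤ a →
      G a k * ∏ i ∈ Finset.range k, (q ^ (i + 1) - 1) =
        ∏ i ∈ Finset.range k, (q ^ (a - k + i + 1) - 1))
    (hG2 : ∀ a k, a < k → G a k = 0) (j a : ℕ) :
    (G (j+1) (a+1) : ℂ) = (q:ℂ)^(a+1) * G j (a+1) + G j a := by
  have cs : ∀ e : ℕ, ((q^e - 1 : ℕ) : ℂ) = (q:ℂ)^e - 1 := by
    intro e
    rw [Nat.cast_sub (Nat.one_le_pow _ _ (by omega))]; push_cast; rfl
  have hG : ∀ a k, k ≤ a →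
      (G a k : ℂ) * ∏ i ∈ Finset.range k, ((q:ℂ) ^ (i + 1) - 1) =
        ∏ i ∈ Finset.range k, ((q:ℂ) ^ (a - k + i + 1) - 1) := by
    intro a k h
    have := congrArg (fun n : ℕ => (n : ℂ)) (hG1 a k h)
    push_cast at this
    simpa only [cs] using this
  have hne : ∀ k : ℕ, (∏ i ∈ Finset.range k, ((q:ℂ) ^ (i + 1) - 1)) ≠ 0 := by
    intro k
    rw [Finset.prod_ne_zero_iff]
    intro i _
    rw [← cs]
    have : 1 < q^(i+1) := Nat.one_lt_pow (by omega) (by omega)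
    exact_mod_cast (by omega : q^(i+1) - 1 ≠ 0)
  rcases lt_or_ge j a with h | h
  · simp [hG2 j a h, hG2 j (a+1) (by omega), hG2 (j+1) (a+1) (by omega)]
  · apply mul_right_cancel₀ (hne (a+1))
    rw [hG (j+1) (a+1) (by omega)]
    have h1 := hG j a h
    have h2 : (G j (a+1) : ℂ) * ∏ i ∈ Finset.range (a+1), ((q:ℂ) ^ (i + 1) - 1) =
       ((q:ℂ)^(j-a) - 1) * ∏ i ∈ Finset.range a, ((q:ℂ) ^ (j - a + i + 1) - 1) := by
      rcases Nat.eq_or_lt_of_le h with h' | h'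
      · subst h'
        simp [hG2 a (a+1) (by omega)]
      · rw [hG j (a+1) h', Finset.prod_range_succ']
        rw [mul_comm]
        congr 1
        · congr 2; omega
        · apply Finset.prod_congr rfl
          intro i _
          congr 2; omega
    rw [add_mul, mul_assoc, h2, Finset.prod_range_succ, Finset.prod_range_succ, ← mul_assoc (G j a : ℂ), h1]
    have e1 : j + 1 - (a+1) + a + 1 = (j - a) + (a + 1) := by omega
    have e2 : j + 1 - (a + 1) = j - a := by omega
    rw [e1, e2, pow_add]
    ring

lemma Sval_eq (G : ℕ → ℕ → ℕ)
    (hG1 : ∀ a k, k ≤ a →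
      G a k * ∏ i ∈ Finset.range k, (Fintype.card F ^ (i + 1) - 1) =
        ∏ i ∈ Finset.range k, (Fintype.card F ^ (a - k + i + 1) - 1))
    (hG2 : ∀ a k, a < k → G a k = 0) (m n lv jv : ℕ) :
    Sval F G m n lv jv = Tv (Fintype.card F) (m - jv) (n - jv) jv lv := by
  have hq0 : (Fintype.card F : ℂ) ≠ 0 := by simp
  have hq2 : 2 ≤ Fintype.card F := Fintype.one_lt_card
  have hP := qpascal (Fintype.card F) hq2 G hG1 hG2
  have h0 : ∀ j, (G j 0 : ℂ) = 1 := by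
    intro j
    have := hG1 j 0 (Nat.zero_le _)
    simp at this
    simp [this]
  unfold Sval
  generalize m - jv = m'
  generalize n - jv = n'
  simp only [NqF_eq]
  set q : ℂ := (Fintype.card F : ℂ) with hq
  induction jv generalizing lv with
  | zero =>
    rw [Finset.sum_eq_single 0]
    · simp [h0, Tv]
    · intro a _ ha
      rw [hG2 0 a (by omega)]; simp
    · simp
  | succ j ih =>
    rcases lv with _ | l
    · rw [Tv, Tv_neg _ _ _ _ (((0:ℕ):ℤ) - 1) (by norm_num), ← ih 0]
      simp [h0]
    · have e0 : (((l+1 : ℕ) : ℤ) - 1) = (l : ℤ) := by push_cast; ring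
      rw [Tv, e0, ← ih (l+1), ← ih l, zpow_natCast, zpow_natCast, Finset.sum_range_succ', Finset.sum_range_succ' (n := l + 1),
        mul_add (q^(l+1)), Finset.mul_sum, Finset.mul_sum, add_sub_right_comm, ← Finset.sum_sub_distrib]
      congr 1
      · apply Finset.sum_congr rfl
        intro a ha
        have ha' : a ≤ l := by simpa [Nat.lt_succ_iff] using ha
        obtain ⟨d, rfl⟩ := Nat.exists_eq_add_of_le ha'
        rw [hP]
        have t1 : a + d + 1 - (a + 1) = d := by omega
        have t2 : a + d - a = d := by omega
        have t3 : (a+1) * (a + 1 - 1)/2 = a * (a-1)/2 + a := by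
          have := Nat.triangle_succ a
          simpa using this
        rw [t1, t2, t3]
        ring
      · simp [h0]
        ring
end tvsec

section pivot
open Module Submodule Matrix
variable {F : Type} [Field F] {n : Type} [Fintype n]

def fullM (A : Matrix n n F) (B C : n → F) (r s : n) (x : F) : Matrix n n F :=
  A + vecMulVec B (Pi.single s 1) + vecMulVec (Pi.single r 1) C
    + x • vecMulVec (Pi.single r 1) (Pi.single s 1)

lemma exists_ker_vec (A : Matrix n n F) (C : n → F) (h : ¬ ∃ v, v ᵥ* A = C) :
    ∃ w, A *ᵥ w = 0 ∧ C ⬝ᵥ w = 1 := by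
  have h' : C ∉ LinearMap.range A.vecMulLinear := by
    rintro ⟨v, hv⟩; exact h ⟨v, hv⟩
  obtain ⟨f, hf, hk⟩ := exists_le_ker_of_notMem h'
  have hfw : ∀ u : n → F, f u = u ⬝ᵥ (fun i => f (Pi.single i 1)) := by
    intro u
    conv_lhs => rw [LinearMap.pi_apply_eq_sum_univ f u]
    simp only [dotProduct, smul_eq_mul]
    apply Finset.sum_congr rfl
    intro i _
    congr 2
    funext j
    simp [Pi.single_apply, eq_comm]
  refine ⟨(f C)⁻¹ • (fun i => f (Pi.single i 1)), ?_, ?_⟩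
  · rw [mulVec_smul]
    have : A *ᵥ (fun i => f (Pi.single i 1)) = 0 := by
      funext i
      have h2 := hk (show (Pi.single i 1) ᵥ* A ∈ LinearMap.range A.vecMulLinear from ⟨_, rfl⟩)
      rw [LinearMap.mem_ker, hfw, ← dotProduct_mulVec] at h2
      simpa using h2
    rw [this, smul_zero]
  · rw [dotProduct_smul, ← hfw, smul_eq_mul, inv_mul_cancel₀ hf]

lemma fullM_transpose (A : Matrix n n F) (B C : n → F) (r s : n) (x : F) :
    (fullM A B C r s x)ᵀ = fullM Aᵀ C B s r x := by
  ext i j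
  simp only [fullM, transpose_apply, Matrix.add_apply, Matrix.smul_apply, vecMulVec_apply, smul_eq_mul]
  ring

lemma rank_fullM_indep_C (A : Matrix n n F) (B C : n → F) (r s : n) (x y : F)
    (hs : ∀ t, A t s = 0) (hC : C s = 0) (h : ¬ ∃ v, v ᵥ* A = C) :
    (fullM A B C r s x).rank = (fullM A B C r s y).rank := by
  obtain ⟨w, hw1, hw2⟩ := exists_ker_vec A C h
  wlog hws : w s = 0 generalizing w
  · refine this (w - w s • Pi.single s 1) ?_ ?_ (by simp)
    · rw [mulVec_sub, hw1, mulVec_smul]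
      funext i
      simp [hs]
    · rw [dotProduct_sub, hw2, dotProduct_smul]
      simp [hC]
  have key : ∀ x y, (fullM A B C r s x).rank ≤ (fullM A B C r s y).rank := by
    intro x y
    have e : fullM A B C r s x = fullM A B C r s y * (1 + (x - y) • vecMulVec w (Pi.single s 1)) := by
      have hm : fullM A B C r s y *ᵥ w = Pi.single r 1 := by
        simp only [fullM, add_mulVec, hw1, vecMulVec_mulVec, hw2, smul_mulVec, single_one_dotProduct, hws]
        simp
      rw [mul_add, mul_one, Matrix.mul_smul, mul_vecMulVec, hm]
      simp only [fullM, sub_smul]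
      abel
    rw [e]
    exact rank_mul_le_left _ _
  exact le_antisymm (key _ _) (key _ _)

lemma rank_fullM_indep_B (A : Matrix n n F) (B C : n → F) (r s : n) (x y : F)
    (hr : ∀ t, A r t = 0) (hB : B r = 0) (h : ¬ ∃ v, A *ᵥ v = B) :
    (fullM A B C r s x).rank = (fullM A B C r s y).rank := by
  rw [← rank_transpose, fullM_transpose, ← rank_transpose (fullM A B C r s y), fullM_transpose]
  exact rank_fullM_indep_C Aᵀ C B s r x y hr hB (by simpa only [vecMul_transpose] using h)

lemma rank_add_single [Fintype F] (A : Matrix n n F) (r s : n) (z : F)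
    (hr : ∀ t, A r t = 0) (hs : ∀ t, A t s = 0) :
    (A + z • vecMulVec (Pi.single r 1) (Pi.single s 1)).rank = A.rank + if z = 0 then 0 else 1 := by
  by_cases hz : z = 0
  · simp [hz]
  · rw [if_neg hz, rank_eq_finrank_span_row, rank_eq_finrank_span_row]
    have hns : (Pi.single s 1 : n → F) ∉ span F (Set.range A.row) := by
      intro h
      have hle : span F (Set.range A.row) ≤ LinearMap.ker (LinearMap.proj (R := F) (φ := fun _ : n => F) s) := by
        rw [span_le]
        rintro _ ⟨i, rfl⟩
        exact hs i
      have := hle h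
      simp at this
    have hrow : ∀ i, i ≠ r → (A + z • vecMulVec (Pi.single r 1) (Pi.single s 1)).row i = A.row i := by
      intro i hi
      funext j
      simp [hi, vecMulVec_apply]
    have hrow2 : (A + z • vecMulVec (Pi.single r 1) (Pi.single s 1)).row r = z • Pi.single s 1 := by
      funext j
      simp [vecMulVec_apply, hr]
    rw [← finrank_sup_sing _ _ hns]
    suffices e : span F (Set.range (A + z • vecMulVec (Pi.single r 1) (Pi.single s 1)).row) =
        span F (Set.range A.row) ⊔ span F {Pi.single s 1} by rw [e]
    apply le_antisymm
    · rw [span_le]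
      rintro _ ⟨i, rfl⟩
      by_cases hi : i = r
      · subst hi
        rw [hrow2]
        exact mem_sup_right (smul_mem _ _ (mem_span_singleton_self _))
      · rw [hrow i hi]
        exact mem_sup_left (subset_span ⟨i, rfl⟩)
    · refine sup_le ?_ ?_
      · rw [span_le]
        rintro _ ⟨i, rfl⟩
        by_cases hi : i = r
        · subst hi
          have : A.row i = 0 := by funext j; exact hr j
          rw [this]; exact zero_mem _
        · rw [← hrow i hi]
          exact subset_span ⟨i, rfl⟩
      · rw [span_singleton_le_iff_mem]
        have hm := smul_mem (span F (Set.range (A + z • vecMulVec (Pi.single r 1) (Pi.single s 1)).row)) z⁻¹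
          (subset_span ⟨r, rfl⟩)
        rwa [hrow2, smul_smul, inv_mul_cancel₀ hz, one_smul] at hm

lemma rank_fullM [Fintype F] (A : Matrix n n F) (v w : n → F) (r s : n) (x : F)
    (hr : ∀ t, A r t = 0) (hs : ∀ t, A t s = 0) :
    (fullM A (A *ᵥ w) (v ᵥ* A) r s x).rank = A.rank + if x = v ⬝ᵥ (A *ᵥ w) then 0 else 1 := by
  have hrs : (A *ᵥ w) r = 0 := by simp [mulVec, dotProduct, hr]
  have hss : (v ᵥ* A) s = 0 := by simp [vecMul, dotProduct, hs]
  wlog hv : v r = 0 generalizing v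
  · have e1 : (v - v r • Pi.single r 1) ᵥ* A = v ᵥ* A := by
      rw [sub_vecMul, smul_vecMul]
      have : (Pi.single r 1 : n → F) ᵥ* A = 0 := by funext j; simp [hr]
      rw [this]; simp
    have := this (v - v r • Pi.single r 1) (by rw [e1]; exact hss) (by simp)
    rw [e1, dotProduct_mulVec, e1, ← dotProduct_mulVec] at this
    exact this
  wlog hw : w s = 0 generalizing w
  · have e1 : A *ᵥ (w - w s • Pi.single s 1) = A *ᵥ w := by
      rw [mulVec_sub, mulVec_smul]
      have : A *ᵥ (Pi.single s 1 : n → F) = 0 := by funext j; simp [hs]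
      rw [this]; simp
    have := this (w - w s • Pi.single s 1) (by rw [e1]; exact hrs) (by simp)
    rw [e1] at this
    exact this
  set z := x - v ⬝ᵥ (A *ᵥ w) with hz
  have hz0 : (x = v ⬝ᵥ (A *ᵥ w)) ↔ z = 0 := by rw [hz, sub_eq_zero]
  simp only [hz0]
  rw [← rank_add_single A r s z hr hs]
  set E : Matrix n n F := vecMulVec (Pi.single r 1) v
  set E' : Matrix n n F := vecMulVec w (Pi.single s 1)
  have hE : E * E = 0 := by
    simp only [E, vecMulVec_mul_vecMulVec]; simp [hv]
  have hE' : E' * E' = 0 := by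
    simp only [E', vecMulVec_mul_vecMulVec]; simp [hw]
  have e1 : fullM A (A *ᵥ w) (v ᵥ* A) r s x = (1 + E) * (A + z • vecMulVec (Pi.single r 1) (Pi.single s 1)) * (1 + E') := by
    have a1 : E * A = vecMulVec (Pi.single r 1) (v ᵥ* A) := by simp only [E, vecMulVec_mul]
    have a2 : E * (z • vecMulVec (Pi.single r 1) (Pi.single s 1)) = 0 := by
      simp only [E, Matrix.mul_smul, vecMulVec_mul_vecMulVec]; simp [hv]
    have a3 : A * E' = vecMulVec (A *ᵥ w) (Pi.single s 1) := by simp only [E', mul_vecMulVec]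
    have a4 : (z • vecMulVec (Pi.single r 1) (Pi.single s 1)) * E' = 0 := by
      simp only [E', smul_mul, vecMulVec_mul_vecMulVec]; simp [hw]
    have a5 : E * A * E' = (v ⬝ᵥ (A *ᵥ w)) • vecMulVec (Pi.single r 1) (Pi.single s 1) := by
      rw [a1]; simp only [E', vecMulVec_mul_vecMulVec, ← dotProduct_mulVec]
      ext i j; simp [vecMulVec_apply]; ring
    have : (1 + E) * (A + z • vecMulVec (Pi.single r 1) (Pi.single s 1)) * (1 + E')
       = A + A * E' + E * A + (E * A * E' + z • vecMulVec (Pi.single r 1) (Pi.single s 1))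
        + (E * (z • vecMulVec (Pi.single r 1) (Pi.single s 1)) * (1 + E') + (z • vecMulVec (Pi.single r 1) (Pi.single s 1)) * E') := by
      generalize (z • vecMulVec (Pi.single r 1) (Pi.single s 1) : Matrix n n F) = Y
      noncomm_ring
    rw [this, a2, a4, a3, a5, a1, fullM, ← add_smul, hz]
    simp
  apply le_antisymm
  · rw [e1]
    exact (rank_mul_le_left _ _).trans (rank_mul_le_right _ _)
  · have e2 : (A + z • vecMulVec (Pi.single r 1) (Pi.single s 1)) = (1 - E) * fullM A (A *ᵥ w) (v ᵥ* A) r s x * (1 - E') := by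
      have b1 : (1 - E) * (1 + E) = 1 := by rw [mul_add, sub_mul, sub_mul, hE]; simp
      have b2 : (1 + E') * (1 - E') = 1 := by rw [mul_sub, add_mul, add_mul, hE']; simp
      rw [e1]
      calc _ = ((1 - E) * (1 + E)) * (A + z • vecMulVec (Pi.single r 1) (Pi.single s 1)) * ((1 + E') * (1 - E')) := by
            rw [b1, b2]; simp
        _ = _ := by simp only [Matrix.mul_assoc]
    rw [e2]
    exact (rank_mul_le_left _ _).trans (rank_mul_le_right _ _)

variable [Fintype F] (ψ : AddChar F ℂ)

lemma sum_subspace (hψ : ψ ≠ 1) (U : Submodule F (n → F)) (v : n → F) :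
    ∑ B : U, ψ (v ⬝ᵥ (B : n → F)) = if (∀ B ∈ U, v ⬝ᵥ B = 0) then ((Fintype.card F : ℂ) ^ finrank F U) else 0 := by
  split_ifs with h
  · rw [Finset.sum_congr rfl (fun B _ => by rw [h B B.2])]
    simp only [AddChar.map_zero_eq_one, Finset.sum_const, Finset.card_univ, nsmul_eq_mul, mul_one]
    rw [Module.card_eq_pow_finrank (K := F)]; push_cast; rfl
  · let φ : AddChar U ℂ := ⟨fun B => ψ (v ⬝ᵥ (B : n → F)), by simp, by
      intro a b; simp [dotProduct_add, AddChar.map_add_eq_mul]⟩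
    refine AddChar.sum_eq_zero_of_ne_one (ψ := φ) ?_
    intro hφ
    push Not at h
    obtain ⟨B, hB, hvB⟩ := h
    apply hψ
    ext a
    have := congrArg (fun f => f (⟨(a / (v ⬝ᵥ B)) • B, U.smul_mem _ hB⟩ : U)) hφ
    change ψ (v ⬝ᵥ ((a / (v ⬝ᵥ B)) • B)) = 1 at this
    rw [dotProduct_smul, smul_eq_mul, div_mul_cancel₀ _ hvB] at this
    simpa using this

lemma pivot_zero (hψ : ψ ≠ 1) (A : Matrix n n F) (B C : n → F) (r s : n) (hr : ∀ t, A r t = 0) (hs : ∀ t, A t s = 0)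
    (hB : B r = 0) (hC : C s = 0) (h : ¬ ((∃ v, v ᵥ* A = C) ∧ (∃ w, A *ᵥ w = B))) (t : ℤ) :
    ∑ x : F, (if ((fullM A B C r s x).rank : ℤ) = t then ψ x else 0) = 0 := by
  have hi : ∀ x, (fullM A B C r s x).rank = (fullM A B C r s 0).rank := by
    intro x
    by_cases h1 : ∃ v, v ᵥ* A = C
    · exact rank_fullM_indep_B A B C r s x 0 hr hB (fun h2 => h ⟨h1, h2⟩)
    · exact rank_fullM_indep_C A B C r s x 0 hs hC h1
  simp only [hi]
  split_ifs
  · exact AddChar.sum_eq_zero_of_ne_one hψ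
  · simp

lemma pivot_one (hψ : ψ ≠ 1) (A : Matrix n n F) (v w : n → F) (r s : n) (hr : ∀ t, A r t = 0) (hs : ∀ t, A t s = 0)
    (t : ℤ) :
    ∑ x : F, (if ((fullM A (A *ᵥ w) (v ᵥ* A) r s x).rank : ℤ) = t then ψ x else 0) =
      ψ (v ⬝ᵥ (A *ᵥ w)) * ((if (A.rank : ℤ) = t then 1 else 0) - (if (A.rank : ℤ) = t - 1 then 1 else 0)) := by
  simp only [rank_fullM A v w r s _ hr hs]
  set x0 := v ⬝ᵥ (A *ᵥ w)
  have h0 : ∑ x : F, ψ x = 0 := AddChar.sum_eq_zero_of_ne_one hψ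
  rw [← Finset.add_sum_erase _ _ (Finset.mem_univ x0)] at h0 ⊢
  have h1 : ∑ x ∈ Finset.univ.erase x0, (if ((A.rank + if x = x0 then 0 else 1 : ℕ) : ℤ) = t then ψ x else 0)
     = ∑ x ∈ Finset.univ.erase x0, ψ x * (if (A.rank : ℤ) = t - 1 then 1 else 0) := by
    apply Finset.sum_congr rfl
    intro x hx
    rw [if_neg (Finset.ne_of_mem_erase hx)]
    have : ((A.rank + 1 : ℕ) : ℤ) = t ↔ (A.rank : ℤ) = t - 1 := by push_cast; omega
    simp only [this]
    split_ifs <;> simp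
  rw [h1, ← Finset.sum_mul, eq_neg_of_add_eq_zero_right h0]
  simp only [if_true, add_zero]
  split_ifs <;> simp

lemma pivot_sum (hψ : ψ ≠ 1) (A : Matrix n n F) (r s : n) (hr : ∀ t, A r t = 0) (hs : ∀ t, A t s = 0)
    (t : ℤ) :
    ∑ C : n → F, ∑ B : n → F, (if (∃ v, v ᵥ* A = C) ∧ (∃ w, A *ᵥ w = B) then
      ∑ x : F, (if ((fullM A B C r s x).rank : ℤ) = t then ψ x else 0) else 0) =
     (Fintype.card F : ℂ) ^ A.rank * ((if (A.rank : ℤ) = t then 1 else 0) - (if (A.rank : ℤ) = t - 1 then 1 else 0)) := by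
  set U := LinearMap.range A.mulVecLin with hU
  set k : ℂ := ((if (A.rank : ℤ) = t then 1 else 0) - (if (A.rank : ℤ) = t - 1 then 1 else 0))
  have hfr : finrank F U = A.rank := rfl
  rw [Finset.sum_eq_single 0]
  · have h1 : ∀ B : n → F, (if (∃ v, v ᵥ* A = 0) ∧ (∃ w, A *ᵥ w = B) then
      ∑ x : F, (if ((fullM A B 0 r s x).rank : ℤ) = t then ψ x else 0) else 0) = if B ∈ U then k else 0 := by
      intro B
      by_cases hB : B ∈ U
      · rw [if_pos hB, if_pos ⟨⟨0, by simp⟩, hB⟩]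
        obtain ⟨w, rfl⟩ := hB
        have := pivot_one ψ hψ A 0 w r s hr hs t
        simp only [zero_vecMul, zero_dotProduct, AddChar.map_zero_eq_one, one_mul] at this
        exact this
      · rw [if_neg hB, if_neg (fun h => hB h.2)]
    simp only [h1]
    rw [← Finset.sum_filter, Finset.sum_const, nsmul_eq_mul, ← Fintype.card_subtype]
    congr 1
    have := Module.card_eq_pow_finrank (K := F) (V := U)
    rw [hfr] at this
    rw [← Nat.cast_pow, ← this]
  · intro C _ hC
    by_cases hv : ∃ v, v ᵥ* A = C
    · obtain ⟨v, rfl⟩ := hv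
      have h1 : ∀ B : n → F, (if (∃ v', v' ᵥ* A = v ᵥ* A) ∧ (∃ w, A *ᵥ w = B) then
        ∑ x : F, (if ((fullM A B (v ᵥ* A) r s x).rank : ℤ) = t then ψ x else 0) else 0) = if B ∈ U then ψ (v ⬝ᵥ B) * k else 0 := by
        intro B
        by_cases hB : B ∈ U
        · rw [if_pos hB, if_pos ⟨⟨v, rfl⟩, hB⟩]
          obtain ⟨w, rfl⟩ := hB
          exact pivot_one ψ hψ A v w r s hr hs t
        · rw [if_neg hB, if_neg (fun h => hB h.2)]
      simp only [h1]
      rw [← Finset.sum_filter, ← Finset.sum_mul]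
      have h2 := sum_subspace ψ hψ U v
      have h3 : ∑ B ∈ Finset.univ.filter (fun B : n → F => B ∈ U), ψ (v ⬝ᵥ B) = ∑ B : U, ψ (v ⬝ᵥ (B : n → F)) := by
        rw [← Finset.sum_subtype_eq_sum_filter]
        refine Finset.sum_bij (fun a _ => ⟨a.1, a.2⟩) ?_ ?_ ?_ ?_ <;> simp
      rw [h3.trans (Eq.trans (by congr!) h2), if_neg, zero_mul]
      intro h4
      apply hC
      funext i
      have := h4 (A *ᵥ Pi.single i 1) ⟨_, rfl⟩
      rw [dotProduct_mulVec] at this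
      simpa using this
    · apply Finset.sum_eq_zero
      intro B _
      rw [if_neg (fun h => hv h.1)]
  · simp

end pivot

section wdefs
open Module Submodule Matrix
variable {F : Type} [Field F] {N l : ℕ} (blk : Fin N → Fin l)

def cor (a b : ℕ) (Z : Matrix (Fin N) (Fin N) F) : Matrix (Fin N) (Fin N) F :=
  fun r s => if (blk r : ℕ) < a ∧ b ≤ (blk s : ℕ) then Z r s else 0

def rectIn (D : Finset (Fin l × Fin l)) (a b : ℕ) : Prop :=
  ∀ i j : Fin l, (i : ℕ) < a → b ≤ (j : ℕ) → (i, j) ∈ D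

def Supp (D : Finset (Fin l × Fin l)) (ρ κ : Finset (Fin N)) (Z : Matrix (Fin N) (Fin N) F) : Prop :=
  ∀ r s, Z r s ≠ 0 → r ∈ ρ ∧ s ∈ κ ∧ (blk r, blk s) ∈ D

def Cond (D : Finset (Fin l × Fin l)) (R : ℕ → ℕ → ℤ) (Z : Matrix (Fin N) (Fin N) F) : Prop :=
  ∀ a b, a ≤ l → b ≤ l → rectIn D a b → ((cor blk a b Z).rank : ℤ) = R a b

def pair (Z M : Matrix (Fin N) (Fin N) F) : F := ∑ r, ∑ s, Z r s * M r s

variable [Fintype F] (ψ : AddChar F ℂ)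

def Wsum (D : Finset (Fin l × Fin l)) (ρ κ : Finset (Fin N)) (R : ℕ → ℕ → ℤ)
    (M : Matrix (Fin N) (Fin N) F) : ℂ :=
  ∑ Z : Matrix (Fin N) (Fin N) F, if Supp blk D ρ κ Z ∧ Cond blk D R Z then ψ (pair Z M) else 0

def W2 (D : Finset (Fin l × Fin l)) (i j : Fin l) (ρ κ : Finset (Fin N)) (R : ℕ → ℕ → ℤ) (t : ℤ)
    (M : Matrix (Fin N) (Fin N) F) : ℂ :=
  ∑ Z : Matrix (Fin N) (Fin N) F, if Supp blk D ρ κ Z ∧ Cond blk (D.erase (i, j)) R Z ∧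
    ((cor blk ((i : ℕ) + 1) j Z).rank : ℤ) = t then ψ (pair Z M) else 0

def Corner (D : Finset (Fin l × Fin l)) (i j : Fin l) : Prop :=
  (∀ k, (i, k) ∈ D ↔ j ≤ k) ∧ (∀ k, (k, j) ∈ D ↔ k ≤ i)

variable {blk}

lemma rect_erase {D : Finset (Fin l × Fin l)} {i j : Fin l} {a b : ℕ}
    (h : rectIn (D.erase (i, j)) a b) : a ≤ i ∨ (j : ℕ) < b := by
  by_contra hc
  push Not at hc
  have := h i j hc.1 hc.2
  simp at this

lemma rank_addcol (X : Matrix (Fin N) (Fin N) F) (w : Fin N → F) (s : Fin N) (hs : ∀ t, X t s = 0) :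
    (X + vecMulVec (X *ᵥ w) (Pi.single s 1)).rank = X.rank := by
  apply le_antisymm
  · have : X + vecMulVec (X *ᵥ w) (Pi.single s 1) = X * (1 + vecMulVec w (Pi.single s 1)) := by
      rw [mul_add, mul_one, mul_vecMulVec]
    rw [this]
    exact rank_mul_le_left _ _
  · have : X = (X + vecMulVec (X *ᵥ w) (Pi.single s 1)) * (diagonal fun k => if k = s then 0 else 1) := by
      ext k m
      rw [mul_diagonal]
      by_cases hm : m = s
      · subst hm; simp [hs]
      · simp [hm, vecMulVec_apply]
    conv_lhs => rw [this]
    exact rank_mul_le_left _ _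

lemma rank_addrow (X : Matrix (Fin N) (Fin N) F) (w : Fin N → F) (s : Fin N) (hs : ∀ t, X s t = 0) :
    (X + vecMulVec (Pi.single s 1) (w ᵥ* X)).rank = X.rank := by
  rw [← rank_transpose, ← rank_transpose X, ← rank_addcol Xᵀ w s hs]
  congr 1
  rw [transpose_add, transpose_vecMulVec, mulVec_transpose]

lemma cond_full {D : Finset (Fin l × Fin l)} {i j : Fin l} {R : ℕ → ℕ → ℤ}
    (Z : Matrix (Fin N) (Fin N) F) (v w : Fin N → F) (r s : Fin N) (hbr : blk r = i) (hbs : blk s = j)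
    (hr : ∀ t, Z r t = 0) (hs : ∀ t, Z t s = 0) (x : F) :
    Cond blk (D.erase (i, j)) R (fullM Z (cor blk (i + 1) j Z *ᵥ w) (v ᵥ* cor blk (i + 1) j Z) r s x) ↔
      Cond blk (D.erase (i, j)) R Z := by
  apply forall_congr'; intro a
  apply forall_congr'; intro b
  apply forall_congr'; intro hal
  apply forall_congr'; intro hbl
  apply forall_congr'; intro hre
  have hrs : ((cor blk a b (fullM Z (cor blk (i + 1) j Z *ᵥ w) (v ᵥ* cor blk (i + 1) j Z) r s x)).rank)
      = (cor blk a b Z).rank := by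
    by_cases ha : a ≤ i
    · rw [← rank_addcol (cor blk a b Z) (fun m => if b ≤ j ∧ (j : ℕ) ≤ blk m then w m else 0) s
        (by intro t; simp [cor, hs])]
      congr 1
      ext k m
      by_cases hk : (blk k : ℕ) < a ∧ b ≤ (blk m : ℕ)
      · have hkr : k ≠ r := by rintro rfl; rw [hbr] at hk; omega
        by_cases hm : m = s
        · subst hm
          rw [hbs] at hk
          have hki : (blk k : ℕ) < i + 1 := by omega
          simp only [cor, hbs, hk, fullM, Matrix.add_apply, Matrix.smul_apply, vecMulVec_apply, hs, mulVec, dotProduct]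
          simp only [ne_eq, hkr, not_false_eq_true, Pi.single_eq_of_ne, zero_mul, smul_zero, add_zero,
            Pi.single_eq_same, mul_one, zero_add, hki, true_and, and_self, if_true]
          apply Finset.sum_congr rfl
          intro y _
          by_cases hy : (j : ℕ) ≤ blk y
          · simp [hy, hk.2.trans hy]
          · simp [hy]
        · simp [cor, hk, fullM, vecMulVec_apply, hkr, hm]
      · have : (cor blk a b Z *ᵥ fun m => if b ≤ j ∧ (j : ℕ) ≤ blk m then w m else 0) k * (Pi.single s 1 : Fin N → F) m = 0 := by
          by_cases hm : m = s
          · subst hm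
            rw [hbs] at hk
            have : (cor blk a b Z *ᵥ fun m => if b ≤ j ∧ (j : ℕ) ≤ blk m then w m else 0) k = 0 := by
              simp only [mulVec, dotProduct]
              apply Finset.sum_eq_zero
              intro y _
              by_cases hka : (blk k : ℕ) < a
              · have : ¬ (b ≤ (j : ℕ)) := fun h => hk ⟨hka, h⟩
                simp [this]
              · simp [cor, hka]
            rw [this, zero_mul]
          · simp [hm]
        rw [Matrix.add_apply, vecMulVec_apply, this]
        simp only [cor, if_neg hk, add_zero]
    · have hb : (j : ℕ) < b := (rect_erase hre).resolve_left ha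
      rw [← rank_addrow (cor blk a b Z) (fun m => if (blk m : ℕ) < i + 1 then v m else 0) r
        (by intro t; simp [cor, hr])]
      congr 1
      ext k m
      by_cases hk : (blk k : ℕ) < a ∧ b ≤ (blk m : ℕ)
      · have hkr : m ≠ s := by rintro rfl; rw [hbs] at hk; omega
        by_cases hm : k = r
        · subst hm
          rw [hbr] at hk
          have hki : (j : ℕ) ≤ blk m := by omega
          simp only [cor, hbr, hk, fullM, Matrix.add_apply, Matrix.smul_apply, vecMulVec_apply, hr, vecMul, dotProduct]
          simp only [ne_eq, hkr, not_false_eq_true, Pi.single_eq_of_ne, mul_zero, smul_zero, add_zero,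
            Pi.single_eq_same, one_mul, zero_add, hki, and_true, and_self, if_true]
          apply Finset.sum_congr rfl
          intro y _
          by_cases hy : (blk y : ℕ) < i + 1
          · have : (blk y : ℕ) < a := by omega
            simp [hy, this]
          · simp [hy]
        · simp [cor, hk, fullM, vecMulVec_apply, hkr, hm]
      · have : (Pi.single r 1 : Fin N → F) k * ((fun m => if (blk m : ℕ) < i + 1 then v m else 0) ᵥ* cor blk a b Z) m = 0 := by
          by_cases hm : k = r
          · subst hm
            rw [hbr] at hk
            have : ((fun m => if (blk m : ℕ) < i + 1 then v m else 0) ᵥ* cor blk a b Z) m = 0 := by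
              simp only [vecMul, dotProduct]
              apply Finset.sum_eq_zero
              intro y _
              have : ¬ (b ≤ (blk m : ℕ)) := fun h => hk ⟨by omega, h⟩
              simp [cor, this]
            rw [this, mul_zero]
          · simp [hm]
        rw [Matrix.add_apply, vecMulVec_apply, this]
        simp only [cor, if_neg hk, add_zero]
  rw [hrs]

lemma cond_full_x {D : Finset (Fin l × Fin l)} {i j : Fin l} {R : ℕ → ℕ → ℤ}
    (Z : Matrix (Fin N) (Fin N) F) (B C : Fin N → F) (r s : Fin N) (hbr : blk r = i) (hbs : blk s = j)
    (x : F) :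
    Cond blk (D.erase (i, j)) R (fullM Z B C r s x) ↔
      Cond blk (D.erase (i, j)) R (fullM Z B C r s 0) := by
  apply forall_congr'; intro a
  apply forall_congr'; intro b
  apply forall_congr'; intro hal
  apply forall_congr'; intro hbl
  apply forall_congr'; intro hre
  have : cor blk a b (fullM Z B C r s x) = cor blk a b (fullM Z B C r s 0) := by
    ext k m
    by_cases hk : k = r
    · by_cases hm : m = s
      · subst hk; subst hm
        have : ¬ ((blk k : ℕ) < a ∧ b ≤ (blk m : ℕ)) := by
          rw [hbr, hbs]
          have := rect_erase hre
          omega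
        simp [cor, this]
      · simp [cor, fullM, vecMulVec_apply, hk, hm]
    · simp [cor, fullM, vecMulVec_apply, hk]
  rw [this]

lemma cor_full {i j : Fin l}
    (Z : Matrix (Fin N) (Fin N) F) (B C : Fin N → F) (r s : Fin N) (hbr : blk r = i) (hbs : blk s = j)
    (x : F) (hB : ∀ k, B k ≠ 0 → blk k ≤ i) (hC : ∀ k, C k ≠ 0 → j ≤ blk k) :
    cor blk (i + 1) j (fullM Z B C r s x) = fullM (cor blk (i + 1) j Z) B C r s x := by
  ext k m
  by_cases h : (blk k : ℕ) < i + 1 ∧ (j : ℕ) ≤ (blk m : ℕ)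
  · simp [cor, fullM, h, vecMulVec_apply]
  · have e1 : B k * (Pi.single s 1 : Fin N → F) m = 0 := by
      by_cases hm : m = s
      · subst hm
        by_contra hb
        have := hB k (left_ne_zero_of_mul hb)
        rw [hbs] at h
        exact h ⟨Nat.lt_succ_of_le this, le_refl _⟩
      · simp [hm]
    have e2 : (Pi.single r 1 : Fin N → F) k * C m = 0 := by
      by_cases hm : k = r
      · subst hm
        by_contra hb
        have := hC m (right_ne_zero_of_mul hb)
        rw [hbr] at h
        exact h ⟨Nat.lt_succ_self _, this⟩
      · simp [hm]
    have e3 : (Pi.single r 1 : Fin N → F) k * (Pi.single s 1 : Fin N → F) m = 0 := by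
      by_cases hm : k = r
      · by_cases hm' : m = s
        · subst hm; subst hm'
          rw [hbr, hbs] at h
          exact (h ⟨Nat.lt_succ_self _, le_refl _⟩).elim
        · simp [hm']
      · simp [hm]
    simp only [cor, fullM, if_neg h, Matrix.add_apply, vecMulVec_apply, Matrix.smul_apply, zero_add, smul_eq_mul]
    have h0 : ∀ a b c : F, a = 0 → b = 0 → c = 0 → 0 = a + b + x * c := by
      rintro _ _ _ rfl rfl rfl; simp
    refine h0 _ _ _ ?_ ?_ ?_
    · convert e1
    · convert e2
    · convert e3

end wdefs

section pivotstep
open Module Submodule Matrix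
variable {F : Type} [Field F] {N l : ℕ} {blk : Fin N → Fin l} [Fintype F]

lemma fullM_apply (A : Matrix (Fin N) (Fin N) F) (B C : Fin N → F) (r s : Fin N) (x : F) (k m : Fin N) :
    fullM A B C r s x k m = A k m + (if m = s then B k else 0) + (if k = r then C m else 0)
      + (if k = r ∧ m = s then x else 0) := by
  simp only [fullM, Matrix.add_apply, vecMulVec_apply, Matrix.smul_apply, Pi.single_apply, smul_eq_mul]
  by_cases hk : k = r <;> by_cases hm : m = s <;> simp [hk, hm]

lemma decomp (D : Finset (Fin l × Fin l)) (ρ κ : Finset (Fin N)) (r s : Fin N)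
    (hr : r ∈ ρ) (hs : s ∈ κ) (hrs : (blk r, blk s) ∈ D) (f : Matrix (Fin N) (Fin N) F → ℂ) :
    ∑ Z, (if Supp blk D ρ κ Z then f Z else 0) =
      ∑ Z, if Supp blk D (ρ.erase r) (κ.erase s) Z then
        ∑ C : Fin N → F, ∑ B : Fin N → F,
          if (∀ k, C k ≠ 0 → k ∈ κ.erase s ∧ (blk r, blk k) ∈ D) ∧
             (∀ k, B k ≠ 0 → k ∈ ρ.erase r ∧ (blk k, blk s) ∈ D) then
            ∑ x : F, f (fullM Z B C r s x) else 0 else 0 := by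
  have e : ∀ Z, (if Supp blk D (ρ.erase r) (κ.erase s) Z then
        ∑ C : Fin N → F, ∑ B : Fin N → F,
          if (∀ k, C k ≠ 0 → k ∈ κ.erase s ∧ (blk r, blk k) ∈ D) ∧
             (∀ k, B k ≠ 0 → k ∈ ρ.erase r ∧ (blk k, blk s) ∈ D) then
            ∑ x : F, f (fullM Z B C r s x) else 0 else 0) =
      ∑ C : Fin N → F, ∑ B : Fin N → F, ∑ x : F,
        if Supp blk D (ρ.erase r) (κ.erase s) Z ∧ (∀ k, C k ≠ 0 → k ∈ κ.erase s ∧ (blk r, blk k) ∈ D) ∧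
             (∀ k, B k ≠ 0 → k ∈ ρ.erase r ∧ (blk k, blk s) ∈ D) then f (fullM Z B C r s x) else 0 := by
    intro Z
    by_cases h : Supp blk D (ρ.erase r) (κ.erase s) Z
    · simp only [h, if_true, true_and]
      apply Finset.sum_congr rfl; intro C _
      apply Finset.sum_congr rfl; intro B _
      split_ifs <;> simp
    · simp [h]
  simp only [e]
  simp only [← Fintype.sum_prod_type']
  rw [← Finset.sum_filter, ← Finset.sum_filter]
  refine Finset.sum_nbij'
    (i := fun Z => ((fun k m => if k = r ∨ m = s then 0 else Z k m : Matrix (Fin N) (Fin N) F),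
      (fun m => if m = s then 0 else Z r m : Fin N → F), (fun k => if k = r then 0 else Z k s : Fin N → F), Z r s))
    (j := fun p => fullM p.1 p.2.2.1 p.2.1 r s p.2.2.2) ?_ ?_ ?_ ?_ ?_
  · intro Z hZ
    simp only [Finset.mem_filter, Finset.mem_univ, true_and] at hZ ⊢
    refine ⟨?_, ?_, ?_⟩
    · intro k m hkm
      by_cases h : k = r ∨ m = s
      · simp [h] at hkm
      · simp only [h, if_false] at hkm
        push Not at h
        have := hZ k m hkm
        simp [this, h]
    · intro k hk
      by_cases h : k = s
      · simp [h] at hk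
      · simp only [h, if_false] at hk
        have := hZ r k hk
        simp [this, h]
    · intro k hk
      by_cases h : k = r
      · simp [h] at hk
      · simp only [h, if_false] at hk
        have := hZ k s hk
        simp [this, h]
  · rintro ⟨Z, C, B, x⟩ h
    simp only [Finset.mem_filter, Finset.mem_univ, true_and] at h ⊢
    obtain ⟨h1, h2, h3⟩ := h
    intro k m hkm
    rw [fullM_apply] at hkm
    by_cases hz : Z k m = 0
    · by_cases hk : k = r
      · subst hk
        by_cases hm : m = s
        · subst hm; exact ⟨hr, hs, hrs⟩
        · simp only [hz, hm, if_false, if_true, and_false, add_zero, zero_add] at hkm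
          have := h2 m hkm
          exact ⟨hr, Finset.mem_of_mem_erase this.1, this.2⟩
      · by_cases hm : m = s
        · subst hm
          simp only [hz, hk, if_false, if_true, false_and, add_zero, zero_add] at hkm
          have := h3 k hkm
          exact ⟨Finset.mem_of_mem_erase this.1, hs, this.2⟩
        · simp [hz, hk, hm] at hkm
    · have := h1 k m hz
      exact ⟨Finset.mem_of_mem_erase this.1, Finset.mem_of_mem_erase this.2.1, this.2.2⟩
  · intro Z hZ
    ext k m
    rw [fullM_apply]
    by_cases hk : k = r <;> by_cases hm : m = s <;> simp [hk, hm]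
  · rintro ⟨Z, C, B, x⟩ h
    simp only [Finset.mem_filter, Finset.mem_univ, true_and] at h
    obtain ⟨h1, h2, h3⟩ := h
    have hZr : ∀ m, Z r m = 0 := by
      intro m; by_contra hc; have := (h1 _ _ hc).1; simp at this
    have hZs : ∀ m, Z m s = 0 := by
      intro m; by_contra hc; have := (h1 _ _ hc).2.1; simp at this
    have hCs : C s = 0 := by
      by_contra hc; have := (h2 _ hc).1; simp at this
    have hBr : B r = 0 := by
      by_contra hc; have := (h3 _ hc).1; simp at this
    refine Prod.ext ?_ (Prod.ext ?_ (Prod.ext ?_ ?_))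
    · ext k m
      by_cases hk : k = r
      · simp [hk, hZr]
      · by_cases hm : m = s
        · simp [hm, hZs]
        · simp [hk, hm, fullM_apply]
    · ext m
      by_cases hm : m = s
      · simp [hm, hCs]
      · simp [hm, fullM_apply, hZr]
    · ext m
      by_cases hm : m = r
      · simp [hm, hBr]
      · simp [hm, fullM_apply, hZs]
    · simp [fullM_apply, hZs, hCs, hBr]
  · intro Z hZ
    congr 1
    ext k m
    rw [fullM_apply]
    by_cases hk : k = r <;> by_cases hm : m = s <;> simp [hk, hm]

lemma pair_full (Z M M' : Matrix (Fin N) (Fin N) F) (B C : Fin N → F) (r s : Fin N) (x : F)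
    (hM : M r s = 1) (hM1 : ∀ m, m ≠ s → M r m = 0) (hM2 : ∀ m, m ≠ r → M m s = 0)
    (hM' : ∀ k m, k ≠ r → m ≠ s → M' k m = M k m)
    (hr : ∀ t, Z r t = 0) (hs : ∀ t, Z t s = 0) (hB : B r = 0) (hC : C s = 0) :
    pair (fullM Z B C r s x) M = pair Z M' + x := by
  have : ∀ k m, fullM Z B C r s x k m * M k m = Z k m * M' k m + (if k = r then if m = s then x else 0 else 0) := by
    intro k m
    rw [fullM_apply]
    by_cases hk : k = r
    · subst hk
      by_cases hm : m = s
      · subst hm; simp [hr, hB, hC, hM]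
      · simp [hm, hM1 m hm, hr]
    · by_cases hm : m = s
      · subst hm; simp [hk, hM2 k hk, hs]
      · simp [hk, hm, hM' k m hk hm]
  simp only [pair, this, Finset.sum_add_distrib]
  simp

lemma pivot_step (ψ : AddChar F ℂ) (hψ : ψ ≠ 1) (D : Finset (Fin l × Fin l)) (i j : Fin l) (hD : Corner D i j)
    (ρ κ : Finset (Fin N)) (R : ℕ → ℕ → ℤ) (t : ℤ) (M M' : Matrix (Fin N) (Fin N) F) (r s : Fin N)
    (hbr : blk r = i) (hbs : blk s = j) (hrρ : r ∈ ρ) (hsκ : s ∈ κ)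
    (hM : M r s = 1) (hM1 : ∀ m, m ≠ s → M r m = 0) (hM2 : ∀ m, m ≠ r → M m s = 0)
    (hM' : ∀ k m, k ≠ r → m ≠ s → M' k m = M k m) :
    W2 blk ψ D i j ρ κ R t M = (Fintype.card F : ℂ) ^ t * W2 blk ψ D i j (ρ.erase r) (κ.erase s) R t M'
      - (Fintype.card F : ℂ) ^ (t - 1) * W2 blk ψ D i j (ρ.erase r) (κ.erase s) R (t - 1) M' := by
  have hrs : (blk r, blk s) ∈ D := by rw [hbr, hbs]; exact (hD.1 j).2 le_rfl
  have e1 : W2 blk ψ D i j ρ κ R t M = ∑ Z, (if Supp blk D ρ κ Z then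
      (if Cond blk (D.erase (i, j)) R Z ∧
    ((cor blk ((i : ℕ) + 1) j Z).rank : ℤ) = t then ψ (pair Z M) else 0) else 0) := by
    unfold W2
    simp only [ite_and]
  rw [e1, decomp D ρ κ r s hrρ hsκ hrs]
  unfold W2
  rw [Finset.mul_sum, Finset.mul_sum, ← Finset.sum_sub_distrib]
  apply Finset.sum_congr rfl
  intro Z _
  by_cases hZ : Supp blk D (ρ.erase r) (κ.erase s) Z
  swap
  · simp [hZ]
  rw [if_pos hZ]
  have hZr : ∀ m, Z r m = 0 := by
    intro m; by_contra hc; have := (hZ _ _ hc).1; simp at this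
  have hZs : ∀ m, Z m s = 0 := by
    intro m; by_contra hc; have := (hZ _ _ hc).2.1; simp at this
  set A := cor blk ((i : ℕ) + 1) j Z with hA
  have hAr : ∀ m, A r m = 0 := by intro m; simp [hA, cor, hZr]
  have hAs : ∀ m, A m s = 0 := by intro m; simp [hA, cor, hZs]
  have hAne : ∀ k m, A k m ≠ 0 → k ∈ ρ.erase r ∧ m ∈ κ.erase s ∧ blk k ≤ i ∧ j ≤ blk m := by
    intro k m h
    simp only [hA, cor] at h
    split_ifs at h with hc
    · have := hZ k m h
      exact ⟨this.1, this.2.1, Nat.lt_succ_iff.1 hc.1, hc.2⟩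
    · exact (h rfl).elim
  have main : ∀ C B : Fin N → F, (if (∀ k, C k ≠ 0 → k ∈ κ.erase s ∧ (blk r, blk k) ∈ D) ∧
             (∀ k, B k ≠ 0 → k ∈ ρ.erase r ∧ (blk k, blk s) ∈ D) then
            ∑ x : F, (if Cond blk (D.erase (i, j)) R (fullM Z B C r s x) ∧
    ((cor blk ((i : ℕ) + 1) j (fullM Z B C r s x)).rank : ℤ) = t then ψ (pair (fullM Z B C r s x) M) else 0) else 0)
      = (if Cond blk (D.erase (i, j)) R Z then ψ (pair Z M') else 0) *
        (if (∃ v, v ᵥ* A = C) ∧ (∃ w, A *ᵥ w = B) then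
      ∑ x : F, (if ((fullM A B C r s x).rank : ℤ) = t then ψ x else 0) else 0) := by
    intro C B
    by_cases hok : (∀ k, C k ≠ 0 → k ∈ κ.erase s ∧ (blk r, blk k) ∈ D) ∧
             (∀ k, B k ≠ 0 → k ∈ ρ.erase r ∧ (blk k, blk s) ∈ D)
    · rw [if_pos hok]
      have hC : C s = 0 := by
        by_contra hc; have := (hok.1 _ hc).1; simp at this
      have hB : B r = 0 := by
        by_contra hc; have := (hok.2 _ hc).1; simp at this
      have hcf : ∀ x, cor blk ((i : ℕ) + 1) j (fullM Z B C r s x) = fullM A B C r s x := by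
        intro x
        apply cor_full Z B C r s hbr hbs x
        · intro k hk
          have := (hok.2 k hk).2
          rw [hbs] at this
          exact (hD.2 _).1 this
        · intro k hk
          have := (hok.1 k hk).2
          rw [hbr] at this
          exact (hD.1 _).1 this
      have hpf : ∀ x, pair (fullM Z B C r s x) M = pair Z M' + x := fun x =>
        pair_full Z M M' B C r s x hM hM1 hM2 hM' hZr hZs hB hC
      simp only [hcf, hpf, cond_full_x Z B C r s hbr hbs, AddChar.map_add_eq_mul]
      by_cases hsp : (∃ v, v ᵥ* A = C) ∧ (∃ w, A *ᵥ w = B)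
      · rw [if_pos hsp]
        obtain ⟨⟨v, rfl⟩, ⟨w, rfl⟩⟩ := hsp
        simp only [hA, cond_full Z v w r s hbr hbs hZr hZs 0]
        by_cases hc : Cond blk (D.erase (i, j)) R Z
        · simp only [hc, true_and, if_true]
          rw [Finset.mul_sum]
          apply Finset.sum_congr rfl
          intro x _
          split_ifs <;> simp
        · simp [hc]
      · rw [if_neg hsp, mul_zero]
        by_cases hc : Cond blk (D.erase (i, j)) R (fullM Z B C r s 0)
        · simp only [hc, true_and]
          refine Eq.trans ?_ ((congrArg (fun y => ψ (pair Z M') * y)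
            (pivot_zero ψ hψ A B C r s hAr hAs hB hC hsp t)).trans (mul_zero _))
          rw [Finset.mul_sum]
          apply Finset.sum_congr rfl
          intro x _
          split_ifs <;> simp
        · simp [hc]
    · rw [if_neg hok]
      symm
      apply mul_eq_zero_of_right
      apply if_neg
      rintro ⟨⟨v, rfl⟩, ⟨w, rfl⟩⟩
      apply hok
      constructor
      · intro k hk
        simp only [vecMul, dotProduct] at hk
        obtain ⟨m, _, hm⟩ := Finset.exists_ne_zero_of_sum_ne_zero hk
        have := hAne _ _ (right_ne_zero_of_mul hm)
        rw [hbr]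
        exact ⟨this.2.1, (hD.1 _).2 this.2.2.2⟩
      · intro k hk
        simp only [mulVec, dotProduct] at hk
        obtain ⟨m, _, hm⟩ := Finset.exists_ne_zero_of_sum_ne_zero hk
        have := hAne _ _ (left_ne_zero_of_mul hm)
        rw [hbs]
        exact ⟨this.1, (hD.2 _).2 this.2.2.1⟩
  simp only [main]
  simp only [← Finset.mul_sum]
  refine Eq.trans (congrArg _ (Eq.trans ?_ (pivot_sum ψ hψ A r s hAr hAs t))) ?_
  · congr!
  simp only [hZ, true_and]
  by_cases hc : Cond blk (D.erase (i, j)) R Z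
  · simp only [hc, true_and, if_true]
    by_cases h1 : (A.rank : ℤ) = t
    · have h2 : ¬ (A.rank : ℤ) = t - 1 := by omega
      rw [if_pos h1, if_pos h1, if_neg h2, if_neg h2, ← h1, zpow_natCast]
      ring
    · rw [if_neg h1, if_neg h1]
      by_cases h2 : (A.rank : ℤ) = t - 1
      · rw [if_pos h2, if_pos h2, ← h2, zpow_natCast]
        ring
      · rw [if_neg h2, if_neg h2]
        ring
  · simp [hc]

end pivotstep

section blockrem
open Module Submodule Matrix
variable {F : Type} [Field F] {N l : ℕ} {blk : Fin N → Fin l}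

def Ks (F : Type) [Field F] (T : Finset (Fin N)) : Submodule F (Fin N → F) where
  carrier := {v | ∀ s, s ∉ T → v s = 0}
  add_mem' := by intro a b ha hb s hs; simp [ha s hs, hb s hs]
  zero_mem' := by intro s _; rfl
  smul_mem' := by intro c a ha s hs; simp [ha s hs]

lemma fr_Ks (T : Finset (Fin N)) : fr (Ks F T) = T.card := by
  let e : Ks F T ≃ₗ[F] (T → F) :=
    { toFun := fun v t => v.1 t
      map_add' := by intros; rfl
      map_smul' := by intros; rfl
      invFun := fun f => ⟨fun s => if h : s ∈ T then f ⟨s, h⟩ else 0, by intro s hs; simp [hs]⟩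
      left_inv := by
        intro v
        ext s
        by_cases h : s ∈ T
        · simp [h]
        · simp [h, v.2 s h]
      right_inv := by intro f; ext s; simp }
  rw [fr, e.finrank_eq]
  simp

lemma span_sup_congr {W ι : Type} [AddCommGroup W] [Module F W] (K : Submodule F W) (f g : ι → W)
    (h : ∀ k, f k - g k ∈ K) : span F (Set.range f) ⊔ K = span F (Set.range g) ⊔ K := by
  have key : ∀ f g : ι → W, (∀ k, f k - g k ∈ K) → span F (Set.range f) ⊔ K ≤ span F (Set.range g) ⊔ K := by
    intro f g h
    refine sup_le ?_ le_sup_right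
    rw [span_le]
    rintro _ ⟨k, rfl⟩
    have : f k = g k + (f k - g k) := by abel
    rw [this]
    exact add_mem (mem_sup_left (subset_span ⟨k, rfl⟩)) (mem_sup_right (h k))
  refine le_antisymm (key f g h) (key g f ?_)
  intro k
  rw [← neg_sub]; exact neg_mem (h k)

lemma span_rows_succ (i : ℕ) (b : ℕ) (Y : Matrix (Fin N) (Fin N) F) {ι : Type} (e : ι → Fin N)
    (he1 : ∀ k, (blk (e k) : ℕ) = i) (he2 : ∀ r s, Y r s ≠ 0 → (blk r : ℕ) = i → ∃ k, e k = r) :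
    span F (Set.range (cor blk (i + 1) b Y).row) =
      span F (Set.range (cor blk i b Y).row) ⊔ span F (Set.range fun k => (cor blk (i + 1) b Y).row (e k)) := by
  have hlt : ∀ r, (blk r : ℕ) ≠ i → (cor blk (i + 1) b Y).row r = (cor blk i b Y).row r := by
    intro r hr
    funext s
    simp only [cor, Matrix.row]
    have : (blk r : ℕ) < i + 1 ↔ (blk r : ℕ) < i := by omega
    simp only [this]
  apply le_antisymm
  · rw [span_le]
    rintro _ ⟨r, rfl⟩
    by_cases hr : (blk r : ℕ) = i
    · by_cases hz : ∃ s, Y r s ≠ 0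
      · obtain ⟨s, hs⟩ := hz
        obtain ⟨k, rfl⟩ := he2 r s hs hr
        exact mem_sup_right (subset_span ⟨k, rfl⟩)
      · push Not at hz
        have : (cor blk (i + 1) b Y).row r = 0 := by
          funext s
          simp [cor, Matrix.row, hz]
        rw [this]; exact zero_mem _
    · rw [hlt r hr]
      exact mem_sup_left (subset_span ⟨r, rfl⟩)
  · refine sup_le ?_ ?_
    · rw [span_le]
      rintro _ ⟨r, rfl⟩
      by_cases hr : (blk r : ℕ) = i
      · have : (cor blk i b Y).row r = 0 := by
          funext s
          simp [cor, Matrix.row, hr]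
        rw [this]; exact zero_mem _
      · rw [← hlt r hr]
        exact subset_span ⟨r, rfl⟩
    · apply span_mono
      rintro _ ⟨k, rfl⟩
      exact ⟨e k, rfl⟩

variable [Fintype F]

lemma fr_disj (T : Finset (Fin N)) (S : Submodule F (Fin N → F)) (h : ∀ v ∈ S, ∀ s ∈ T, v s = 0) :
    fr (S ⊔ Ks F T) = fr S + T.card := by
  have h1 := finrank_sup_add_finrank_inf_eq S (Ks F T)
  have : S ⊓ Ks F T = ⊥ := by
    rw [eq_bot_iff]
    rintro v ⟨hv1, hv2⟩
    rw [mem_bot]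
    funext s
    by_cases hs : s ∈ T
    · exact h v hv1 s hs
    · exact hv2 s hs
  rw [this, finrank_bot] at h1
  rw [← fr_Ks (F := F) T]
  simpa [fr] using h1

lemma count_block (i j : Fin l) (ρ κ : Finset (Fin N)) (R : ℕ → ℕ → ℤ) (t : ℤ)
    (Z : Matrix (Fin N) (Fin N) F) (hZ : ∀ r s, Z r s ≠ 0 → r ∈ ρ ∧ s ∈ κ ∧ (blk r, blk s) ≠ (i, j))
    (b : ℕ) (e : Fin b ≃ {r // r ∈ ρ ∧ blk r = i})
    (h1 : ((cor blk i j Z).rank : ℤ) = R i j) (h2 : ((cor blk i (j + 1) Z).rank : ℤ) = R i (j + 1))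
    (h3 : ((cor blk (i + 1) (j + 1) Z).rank : ℤ) = R (i + 1) (j + 1))
    (T : Finset (Fin N)) (hT : T = κ.filter fun s => blk s = j) (c : ℕ) (hc : T.card = c) (x y : ℤ)
    (hx : x = R (i + 1) (j + 1) - R i (j + 1)) (hy : y = R i j - R i (j + 1))
    (Xm : (Fin b → Ks F T) → Matrix (Fin N) (Fin N) F)
    (hX1 : ∀ X k, Xm X (e k) = X k) (hX2 : ∀ X r, blk r ≠ i → Xm X r = 0)
    (hX3 : ∀ X r, r ∉ ρ → Xm X r = 0) :
    ∑ X, (if ((cor blk (i + 1) j (Z + Xm X)).rank : ℤ) = t then (1 : ℂ) else 0) =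
      (Fintype.card F : ℂ) ^ ((b : ℤ) * c - (b - x) * (c - y)) *
        Nr (Fintype.card F) (b - x).toNat (c - y).toNat (t - (R i j + x)) := by
  set S := span F (Set.range (cor blk i j Z).row) with hS
  set C : Fin b → (Fin N → F) := fun k => (cor blk (i + 1) (j + 1) Z).row (e k) with hC
  have he1 : ∀ k, (blk (e k : Fin N) : ℕ) = i := fun k => by rw [(e k).2.2]
  have hrk : ∀ X, (cor blk (i + 1) j (Z + Xm X)).rank = fr (S ⊔ span F (Set.range fun k => (X k : Fin N → F) + C k)) := by
    intro X
    rw [rank_eq_finrank_span_row, span_rows_succ (i : ℕ) j (Z + Xm X) (fun k => (e k : Fin N)) he1]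
    · have e1 : cor blk i j (Z + Xm X) = cor blk i j Z := by
        ext r s
        simp only [cor]
        split_ifs with h
        · have : blk r ≠ i := by rintro h'; rw [h'] at h; omega
          simp [hX2 X r this]
        · rfl
      have e2 : (fun k => (cor blk (i + 1) j (Z + Xm X)).row (e k)) = (fun k => (X k : Fin N → F) + C k) := by
        funext k s
        simp only [cor, Matrix.row, hC, Pi.add_apply, Matrix.add_apply, he1, hX1]
        have hbk : blk (e k : Fin N) = i := (e k).2.2
        by_cases hs : blk s = j
        · have hz : Z (e k) s = 0 := by
            by_contra hz; exact (hZ _ _ hz).2.2 (by rw [hbk, hs])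
          simp [hz, hs]
        · have hx0 : (X k : Fin N → F) s = 0 := (X k).2 s (by simp [hT, hs])
          have : (j : ℕ) ≤ blk s ↔ (j : ℕ) + 1 ≤ blk s := by
            have : (blk s : ℕ) ≠ j := fun h => hs (Fin.ext h)
            omega
          simp [hx0, this]
      rw [e1, e2]; rfl
    · intro r s hrs hbr
      have hbr' : blk r = i := Fin.ext hbr
      have hr : r ∈ ρ := by
        by_contra hr
        rw [Matrix.add_apply, hX3 X r hr] at hrs
        simp only [Pi.zero_apply, add_zero] at hrs
        exact hr (hZ _ _ hrs).1
      exact ⟨e.symm ⟨r, hr, hbr'⟩, by simp⟩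
  have hSK : fr (S ⊔ (Ks F T)) = (cor blk i (j + 1) Z).rank + c := by
    rw [hS, span_sup_congr (Ks F T) (cor blk i j Z).row (cor blk i (j + 1) Z).row, fr_disj, hc, rank_eq_finrank_span_row]
    · rfl
    · intro v hv s hs
      have hle : span F (Set.range (cor blk i (j + 1) Z).row) ≤ LinearMap.ker (LinearMap.proj (R := F) (φ := fun _ : Fin N => F) s) := by
        rw [span_le]
        rintro _ ⟨r, rfl⟩
        rw [hT] at hs
        have : blk s = j := (Finset.mem_filter.1 hs).2
        simp [cor, this, Matrix.row]
      exact hle hv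
    · intro r s hs
      simp only [cor, Matrix.row, Pi.sub_apply]
      by_cases hz : Z r s = 0
      · simp [hz]
      · have hsκ := (hZ r s hz).2.1
        have hsj : blk s ≠ j := fun h => hs (by simp [hT, h, hsκ])
        have : (j : ℕ) ≤ blk s ↔ (j : ℕ) + 1 ≤ blk s := by
          have : (blk s : ℕ) ≠ j := fun h => hsj (Fin.ext h)
          omega
        simp [this]
  have hSKC : fr (S ⊔ (Ks F T) ⊔ span F (Set.range C)) = (cor blk (i + 1) (j + 1) Z).rank + c := by
    have e0 : S ⊔ (Ks F T) = span F (Set.range (cor blk i (j + 1) Z).row) ⊔ (Ks F T) := by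
      rw [hS, span_sup_congr (Ks F T) (cor blk i j Z).row (cor blk i (j + 1) Z).row]
      intro r s hs
      simp only [cor, Matrix.row, Pi.sub_apply]
      by_cases hz : Z r s = 0
      · simp [hz]
      · have hsκ := (hZ r s hz).2.1
        have hsj : blk s ≠ j := fun h => hs (by simp [hT, h, hsκ])
        have : (j : ℕ) ≤ blk s ↔ (j : ℕ) + 1 ≤ blk s := by
          have : (blk s : ℕ) ≠ j := fun h => hsj (Fin.ext h)
          omega
        simp [this]
    rw [e0, sup_right_comm, ← span_rows_succ (i : ℕ) (j + 1) Z (fun k => (e k : Fin N)) he1, fr_disj, hc, rank_eq_finrank_span_row]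
    · rfl
    · intro v hv s hs
      have hle : span F (Set.range (cor blk (i + 1) (j + 1) Z).row) ≤ LinearMap.ker (LinearMap.proj (R := F) (φ := fun _ : Fin N => F) s) := by
        rw [span_le]
        rintro _ ⟨r, rfl⟩
        rw [hT] at hs
        have : blk s = j := (Finset.mem_filter.1 hs).2
        simp [cor, this, Matrix.row]
      exact hle hv
    · intro r s hrs hbr
      exact ⟨e.symm ⟨r, (hZ _ _ hrs).1, Fin.ext hbr⟩, by simp⟩
  have hfS : fr S = (cor blk i j Z).rank := by rw [rank_eq_finrank_span_row]; rfl
  have hle1 : fr (S ⊔ (Ks F T) ⊔ span F (Set.range C)) ≤ fr (S ⊔ (Ks F T)) + b := by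
    have := finrank_add_le_finrank_add_finrank (S ⊔ (Ks F T)) (span F (Set.range C))
    have h' := finrank_range_le_card (R := F) C
    rw [Fintype.card_fin] at h'
    exact this.trans (Nat.add_le_add_left h' _)
  have hle2 : fr S ≤ fr (S ⊔ (Ks F T)) := finrank_mono le_sup_left
  obtain ⟨r', hr'⟩ : ∃ r', r' + fr (S ⊔ (Ks F T) ⊔ span F (Set.range C)) = b + fr (S ⊔ (Ks F T)) :=
    ⟨b + fr (S ⊔ (Ks F T)) - fr (S ⊔ (Ks F T) ⊔ span F (Set.range C)), by omega⟩
  obtain ⟨c', hc'⟩ : ∃ c', c' + fr S = fr (S ⊔ (Ks F T)) := ⟨fr (S ⊔ (Ks F T)) - fr S, by omega⟩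
  have hm := count_main (Ks F T) b S C t r' c' hr' hc'
  have hb' : (b : ℤ) - x = r' := by rw [hx, ← h2, ← h3]; omega
  have hcc : (c : ℤ) - y = c' := by rw [hy, ← h2, ← h1]; omega
  have hq : (Fintype.card F : ℂ) ≠ 0 := by simp
  simp only [hrk]
  have hq2 : (Fintype.card F : ℂ) ^ (r' * c') ≠ 0 := pow_ne_zero _ hq
  rw [hb', hcc, zpow_sub₀ hq, Int.toNat_natCast, Int.toNat_natCast]
  have hfK : fr (Ks F T) = c := by rw [fr_Ks, hc]
  rw [hfK] at hm
  have ht : t - (R i j + x) = t - (fr S + (fr (S ⊔ (Ks F T) ⊔ span F (Set.range C)) - fr (S ⊔ (Ks F T)) : ℤ)) := by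
    rw [hSK, hSKC, hfS, hx, ← h1, ← h2, ← h3]; push_cast; ring
  rw [ht]
  have z1 : (Fintype.card F : ℂ) ^ ((b : ℤ) * c) = (Fintype.card F : ℂ) ^ (b * c) := by
    rw [← zpow_natCast]; push_cast; rfl
  have z2 : (Fintype.card F : ℂ) ^ ((r' : ℤ) * c') = (Fintype.card F : ℂ) ^ (r' * c') := by
    rw [← zpow_natCast]; push_cast; rfl
  rw [z1, z2, div_mul_eq_mul_div, eq_div_iff hq2]
  refine Eq.trans ?_ hm
  congr 1

def Xmat {b : ℕ} {i : Fin l} {ρ : Finset (Fin N)} {T : Finset (Fin N)} (e : Fin b ≃ {r // r ∈ ρ ∧ blk r = i})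
    (X : Fin b → Ks F T) : Matrix (Fin N) (Fin N) F :=
  fun r => if h : r ∈ ρ ∧ blk r = i then (X (e.symm ⟨r, h⟩)).1 else 0

lemma Xmat_ne {b : ℕ} {i : Fin l} {ρ : Finset (Fin N)} {T : Finset (Fin N)} (e : Fin b ≃ {r // r ∈ ρ ∧ blk r = i})
    (X : Fin b → Ks F T) (r s : Fin N) (h : Xmat e X r s ≠ 0) : r ∈ ρ ∧ blk r = i ∧ s ∈ T := by
  unfold Xmat at h
  split_ifs at h with hr
  · refine ⟨hr.1, hr.2, ?_⟩
    by_contra hs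
    exact h ((X (e.symm ⟨r, hr⟩)).2 s hs)
  · exact (h rfl).elim

lemma decomp2 (D : Finset (Fin l × Fin l)) (i j : Fin l) (hij : (i, j) ∈ D) (ρ κ : Finset (Fin N)) (b : ℕ)
    (e : Fin b ≃ {r // r ∈ ρ ∧ blk r = i}) (T : Finset (Fin N)) (hT : T = κ.filter fun s => blk s = j)
    (f : Matrix (Fin N) (Fin N) F → ℂ) :
    ∑ Z, (if Supp blk D ρ κ Z then f Z else 0) =
      ∑ Z, if Supp blk (D.erase (i, j)) ρ κ Z then ∑ X : Fin b → Ks F T, f (Z + Xmat e X) else 0 := by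
  have e1 : ∀ Z, (if Supp blk (D.erase (i, j)) ρ κ Z then ∑ X : Fin b → Ks F T, f (Z + Xmat e X) else 0) =
      ∑ X : Fin b → Ks F T, if Supp blk (D.erase (i, j)) ρ κ Z then f (Z + Xmat e X) else 0 := by
    intro Z
    split_ifs <;> simp
  simp only [e1]
  simp only [← Fintype.sum_prod_type']
  rw [← Finset.sum_filter, ← Finset.sum_filter]
  have hinv : ∀ Z, Supp blk D ρ κ Z → (show Matrix (Fin N) (Fin N) F from fun k m => if blk k = i ∧ blk m = j then 0 else Z k m)
      + Xmat e (fun k => (⟨fun s => if s ∈ T then Z (e k) s else 0, by intro s hs; simp [hs]⟩ : Ks F T)) = Z := by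
    intro Z hZ
    ext k m
    rw [Matrix.add_apply]
    unfold Xmat
    by_cases hk : k ∈ ρ ∧ blk k = i
    · simp only [hk, and_self, dite_true, true_and, Equiv.apply_symm_apply]
      by_cases hm : blk m = j
      · by_cases hm2 : m ∈ κ
        · simp [hT, hm, hm2]
        · have : Z k m = 0 := by
            by_contra hz; exact hm2 (hZ _ _ hz).2.1
          simp [hm, hT, hm2, this]
      · simp [hT, hm]
    · simp only [hk, dite_false, Pi.zero_apply, add_zero]
      by_cases hz : Z k m = 0
      · simp [hz]
      · have hkρ := (hZ _ _ hz).1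
        have : blk k ≠ i := fun h => hk ⟨hkρ, h⟩
        simp [this]
  refine Finset.sum_nbij'
    (i := fun Z => ((fun k m => if blk k = i ∧ blk m = j then 0 else Z k m : Matrix (Fin N) (Fin N) F),
      (fun k => (⟨fun s => if s ∈ T then Z (e k) s else 0, by intro s hs; simp [hs]⟩ : Ks F T))))
    (j := fun p => p.1 + Xmat e p.2) ?_ ?_ ?_ ?_ ?_
  · intro Z hZ
    simp only [Finset.mem_filter, Finset.mem_univ, true_and] at hZ ⊢
    intro k m hkm
    by_cases h : blk k = i ∧ blk m = j
    · simp [h] at hkm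
    · simp only [h, if_false] at hkm
      have := hZ k m hkm
      refine ⟨this.1, this.2.1, ?_⟩
      rw [Finset.mem_erase]
      refine ⟨?_, this.2.2⟩
      intro h'
      exact h ⟨congrArg Prod.fst h', congrArg Prod.snd h'⟩
  · rintro ⟨Z, X⟩ h
    simp only [Finset.mem_filter, Finset.mem_univ, true_and] at h ⊢
    intro k m hkm
    by_cases hz : Z k m = 0
    · rw [Matrix.add_apply, hz, zero_add] at hkm
      obtain ⟨h1, h2, h3⟩ := Xmat_ne e X k m hkm
      rw [hT, Finset.mem_filter] at h3
      rw [h2, h3.2]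
      exact ⟨h1, h3.1, hij⟩
    · have := h k m hz
      exact ⟨this.1, this.2.1, Finset.mem_of_mem_erase this.2.2⟩
  · intro Z hZ
    simp only [Finset.mem_filter, Finset.mem_univ, true_and] at hZ
    exact hinv Z hZ
  · rintro ⟨Z, X⟩ h
    simp only [Finset.mem_filter, Finset.mem_univ, true_and] at h
    have hz : ∀ k m, blk k = i → blk m = j → Z k m = 0 := by
      intro k m hk hm
      by_contra hc
      have := (h _ _ hc).2.2
      rw [hk, hm] at this
      simp at this
    refine Prod.ext ?_ ?_
    · ext k m
      by_cases hc : blk k = i ∧ blk m = j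
      · simp [hc, hz k m hc.1 hc.2]
      · simp only [hc, if_false, Matrix.add_apply]
        have : Xmat e X k m = 0 := by
          by_contra h'
          obtain ⟨h1, h2, h3⟩ := Xmat_ne e X k m h'
          rw [hT, Finset.mem_filter] at h3
          exact hc ⟨h2, h3.2⟩
        simp [this]
    · funext k
      ext s
      have hek := (e k).2
      by_cases hs : s ∈ T
      · have hs' := hs
        rw [hT, Finset.mem_filter] at hs'
        simp [hs, Xmat, hek, hz (e k) s hek.2 hs'.2]
      · have := (X k).2 s hs
        simp [hs, this]
  · intro Z hZ
    simp only [Finset.mem_filter, Finset.mem_univ, true_and] at hZ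
    exact congrArg f (hinv Z hZ).symm

def UpR (D : Finset (Fin l × Fin l)) : Prop :=
  ∀ i i' j j', (i, j) ∈ D → i' ≤ i → j ≤ j' → (i', j') ∈ D

lemma block_removal (ψ : AddChar F ℂ) (D : Finset (Fin l × Fin l)) (hU : UpR D) (i j : Fin l) (hD : Corner D i j)
    (ρ κ : Finset (Fin N)) (R : ℕ → ℕ → ℤ) (t : ℤ) (M : Matrix (Fin N) (Fin N) F)
    (hM : ∀ r s, r ∈ ρ → s ∈ κ → blk r = i → blk s = j → M r s = 0) (b c : ℕ)
    (hb : (ρ.filter fun s => blk s = i).card = b)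
    (hc : (κ.filter fun s => blk s = j).card = c) (x y : ℤ)
    (hx : x = R (i + 1) (j + 1) - R i (j + 1)) (hy : y = R i j - R i (j + 1)) :
    W2 blk ψ D i j ρ κ R t M = (Fintype.card F : ℂ) ^ ((b : ℤ) * c - (b - x) * (c - y)) *
        Nr (Fintype.card F) (b - x).toNat (c - y).toNat (t - (R i j + x)) *
      Wsum blk ψ (D.erase (i, j)) ρ κ R M := by
  have hij : (i, j) ∈ D := (hD.1 j).2 le_rfl
  have hcardb : Fintype.card {r // r ∈ ρ ∧ blk r = i} = b := by
    rw [← hb, Fintype.card_subtype]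
    congr 1
    ext r; simp
  let e : Fin b ≃ {r // r ∈ ρ ∧ blk r = i} := (Fintype.equivFinOfCardEq hcardb).symm
  have e1 : W2 blk ψ D i j ρ κ R t M = ∑ Z, (if Supp blk D ρ κ Z then
      (if Cond blk (D.erase (i, j)) R Z ∧
    ((cor blk ((i : ℕ) + 1) j Z).rank : ℤ) = t then ψ (pair Z M) else 0) else 0) := by
    unfold W2
    simp only [ite_and]
  rw [e1, decomp2 D i j hij ρ κ b e _ rfl]
  unfold Wsum
  rw [Finset.mul_sum]
  apply Finset.sum_congr rfl
  intro Z _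
  by_cases hZ : Supp blk (D.erase (i, j)) ρ κ Z
  swap
  · simp [hZ]
  rw [if_pos hZ]
  have hp : ∀ X : Fin b → Ks F (κ.filter fun s => blk s = j), pair (Z + Xmat e X) M = pair Z M := by
    intro X
    unfold pair
    apply Finset.sum_congr rfl; intro r _
    apply Finset.sum_congr rfl; intro s _
    rw [Matrix.add_apply]
    by_cases h : Xmat e X r s = 0
    · simp [h]
    · obtain ⟨h1, h2, h3⟩ := Xmat_ne e X r s h
      rw [Finset.mem_filter] at h3
      rw [hM r s h1 h3.1 h2 h3.2]; simp
  have hcd : ∀ X : Fin b → Ks F (κ.filter fun s => blk s = j), Cond blk (D.erase (i, j)) R (Z + Xmat e X) ↔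
      Cond blk (D.erase (i, j)) R Z := by
    intro X
    apply forall_congr'; intro a
    apply forall_congr'; intro b
    apply forall_congr'; intro hal
    apply forall_congr'; intro hbl
    apply forall_congr'; intro hre
    have : cor blk a b (Z + Xmat e X) = cor blk a b Z := by
      ext r s
      simp only [cor, Matrix.add_apply]
      by_cases h : Xmat e X r s = 0
      · simp [h]
      · obtain ⟨h1, h2, h3⟩ := Xmat_ne e X r s h
        rw [Finset.mem_filter] at h3
        have := rect_erase hre
        have : ¬ ((blk r : ℕ) < a ∧ b ≤ (blk s : ℕ)) := by rw [h2, h3.2]; omega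
        simp [this]
    rw [this]
  simp only [hp, hcd, hZ, true_and]
  by_cases hCd : Cond blk (D.erase (i, j)) R Z
  swap
  · simp [hCd]
  simp only [hCd, true_and, if_true]
  have rect : ∀ a b : ℕ, a ≤ (i : ℕ) + 1 → (j : ℕ) ≤ b → (a ≤ (i : ℕ) ∨ (j : ℕ) < b) → rectIn (D.erase (i, j)) a b := by
    intro a b ha hb hab i' j' hi' hj'
    rw [Finset.mem_erase]
    constructor
    · intro h
      have h1 : i' = i := congrArg Prod.fst h
      have h2 : j' = j := congrArg Prod.snd h
      rw [h1] at hi'; rw [h2] at hj'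
      omega
    · refine hU i i' j j' hij ?_ ?_
      · rw [Fin.le_def]; omega
      · rw [Fin.le_def]; omega
  have hil := i.2
  have hjl := j.2
  have hcb := count_block i j ρ κ R t Z (by
      intro r s h
      have := hZ r s h
      exact ⟨this.1, this.2.1, (Finset.mem_erase.1 this.2.2).1⟩) b e
      (hCd _ _ (by omega) (by omega) (rect _ _ (by omega) (by omega) (by omega)))
      (hCd _ _ (by omega) (by omega) (rect _ _ (by omega) (by omega) (by omega)))
      (hCd _ _ (by omega) (by omega) (rect _ _ (by omega) (by omega) (by omega)))
      _ rfl c hc x y hx hy (Xmat e)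
      (by intro X k; have := (e k).2; unfold Xmat; rw [dif_pos this]; simp)
      (by intro X r hr; unfold Xmat; rw [dif_neg (fun h => hr h.2)])
      (by intro X r hr; unfold Xmat; rw [dif_neg (fun h => hr h.1)])
  rw [← hcb, Finset.sum_mul]
  apply Finset.sum_congr rfl
  intro X _
  split_ifs <;> simp

end blockrem

section combined
open Module Submodule Matrix
variable {F : Type} [Field F] {N l : ℕ} {blk : Fin N → Fin l}

def ones (blk : Fin N → Fin l) (M : Matrix (Fin N) (Fin N) F) (i j : Fin l) : Finset (Fin N × Fin N) :=
  Finset.univ.filter fun p => blk p.1 = i ∧ blk p.2 = j ∧ M p.1 p.2 ≠ 0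

def blkc (blk : Fin N → Fin l) (ρ : Finset (Fin N)) (i : Fin l) : ℕ := (ρ.filter fun s => blk s = i).card

lemma blkc_erase (ρ : Finset (Fin N)) (r : Fin N) (hr : r ∈ ρ) (i : Fin l) :
    blkc blk (ρ.erase r) i + (if i = blk r then 1 else 0) = blkc blk ρ i := by
  unfold blkc
  rw [Finset.filter_erase]
  split_ifs with h
  · rw [Finset.card_erase_of_mem (by simp [hr, h])]
    have : 0 < (ρ.filter fun s => blk s = i).card := Finset.card_pos.2 ⟨r, by simp [hr, h]⟩
    omega
  · rw [Finset.erase_eq_of_notMem (by simp [Ne.symm h])]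
    rfl

variable [Fintype F]

lemma combined (ψ : AddChar F ℂ) (hψ : ψ ≠ 1) (D : Finset (Fin l × Fin l)) (hU : UpR D) (i j : Fin l)
    (hD : Corner D i j) (R : ℕ → ℕ → ℤ) (x y : ℤ)
    (hx : x = R (i + 1) (j + 1) - R i (j + 1)) (hy : y = R i j - R i (j + 1)) :
    ∀ (k : ℕ) (ρ κ : Finset (Fin N)) (M : Matrix (Fin N) (Fin N) F), IsPPM M → Supp blk D ρ κ M →
      (ones blk M i j).card = k →
      ∃ ρ' κ' M', IsPPM M' ∧ Supp blk (D.erase (i, j)) ρ' κ' M' ∧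
        (∀ i' j', (i', j') ≠ (i, j) → ones blk M' i' j' = ones blk M i' j') ∧
        (∀ i', blkc blk ρ' i' + (if i' = i then k else 0) = blkc blk ρ i') ∧
        (∀ i', blkc blk κ' i' + (if i' = j then k else 0) = blkc blk κ i') ∧
        ∀ t : ℤ, W2 blk ψ D i j ρ κ R t M =
          (Fintype.card F : ℂ) ^ ((k : ℤ) * R i (j + 1) + blkc blk ρ i * y + blkc blk κ j * x - x * y) *
          Tv (Fintype.card F) ((blkc blk ρ i : ℤ) - k - x).toNat ((blkc blk κ j : ℤ) - k - y).toNat k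
            (t - (R i j + x)) * Wsum blk ψ (D.erase (i, j)) ρ' κ' R M' := by
  have hq : (Fintype.card F : ℂ) ≠ 0 := by simp
  intro k
  induction k with
  | zero =>
    intro ρ κ M hM hS hk
    have h0 : ∀ r s, blk r = i → blk s = j → M r s = 0 := by
      intro r s hr hs
      by_contra hc
      rw [Finset.card_eq_zero] at hk
      have : (r, s) ∈ ones blk M i j := by simp [ones, hr, hs, hc]
      rw [hk] at this
      simp at this
    refine ⟨ρ, κ, M, hM, ?_, fun _ _ _ => rfl, by simp, by simp, ?_⟩
    · intro r s hrs
      have := hS r s hrs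
      refine ⟨this.1, this.2.1, Finset.mem_erase.2 ⟨?_, this.2.2⟩⟩
      intro h
      exact hrs (h0 r s (congrArg Prod.fst h) (congrArg Prod.snd h))
    · intro t
      rw [block_removal ψ D hU i j hD ρ κ R t M (fun r s _ _ hr hs => h0 r s hr hs) _ _ rfl rfl x y hx hy]
      rw [Tv]
      simp only [blkc, Nat.cast_zero, zero_mul, zero_add, sub_zero]
      congr 3
      ring
  | succ k ih =>
    intro ρ κ M hM hS hk
    obtain ⟨⟨r, s⟩, hrs⟩ : (ones blk M i j).Nonempty := Finset.card_pos.1 (by omega)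
    have hrs' := hrs
    simp only [ones, Finset.mem_filter, Finset.mem_univ, true_and] at hrs
    obtain ⟨hbr, hbs, hne⟩ := hrs
    obtain ⟨hrρ, hsκ, -⟩ := hS r s hne
    have hM1 : M r s = 1 := (hM.1 r s).resolve_left hne
    set M1 : Matrix (Fin N) (Fin N) F := fun k m => if k = r ∧ m = s then 0 else M k m with hM1d
    have hM1ne : ∀ k m, M1 k m ≠ 0 → M k m ≠ 0 ∧ k ≠ r ∧ m ≠ s := by
      intro k m h
      simp only [hM1d] at h
      split_ifs at h with hc
      · exact (h rfl).elim
      · refine ⟨h, ?_, ?_⟩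
        · rintro rfl
          exact hc ⟨rfl, hM.2.1 _ _ _ h hne⟩
        · rintro rfl
          exact hc ⟨hM.2.2 _ _ _ h hne, rfl⟩
    have hP1 : IsPPM M1 := by
      refine ⟨?_, ?_, ?_⟩
      · intro k m
        simp only [hM1d]
        split_ifs
        · exact Or.inl rfl
        · exact hM.1 k m
      · intro k m t h1 h2
        exact hM.2.1 k m t (hM1ne _ _ h1).1 (hM1ne _ _ h2).1
      · intro k m t h1 h2
        exact hM.2.2 k m t (hM1ne _ _ h1).1 (hM1ne _ _ h2).1
    have hS1 : Supp blk D (ρ.erase r) (κ.erase s) M1 := by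
      intro k m h
      obtain ⟨h1, h2, h3⟩ := hM1ne k m h
      have := hS k m h1
      exact ⟨Finset.mem_erase.2 ⟨h2, this.1⟩, Finset.mem_erase.2 ⟨h3, this.2.1⟩, this.2.2⟩
    have hones : ∀ i' j', ones blk M1 i' j' = (ones blk M i' j').erase (r, s) := by
      intro i' j'
      ext ⟨k, m⟩
      simp only [ones, Finset.mem_filter, Finset.mem_univ, true_and, Finset.mem_erase, ne_eq, Prod.mk.injEq, hM1d]
      by_cases h : k = r ∧ m = s
      · simp [h]
      · simp [h]
    have hk1 : (ones blk M1 i j).card = k := by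
      rw [hones, Finset.card_erase_of_mem hrs', hk]; rfl
    obtain ⟨ρ', κ', M', h1, h2, h3, h4, h5, h6⟩ := ih (ρ.erase r) (κ.erase s) M1 hP1 hS1 hk1
    have hρe := blkc_erase (blk := blk) ρ r hrρ
    have hκe := blkc_erase (blk := blk) κ s hsκ
    rw [hbr] at hρe
    rw [hbs] at hκe
    refine ⟨ρ', κ', M', h1, h2, ?_, ?_, ?_, ?_⟩
    · intro i' j' h
      rw [h3 i' j' h, hones]
      apply Finset.erase_eq_of_notMem
      simp only [ones, Finset.mem_filter, Finset.mem_univ, true_and, hbr, hbs]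
      rintro ⟨rfl, rfl, -⟩
      exact h rfl
    · intro i'
      rw [← hρe i', ← h4 i']
      split_ifs <;> omega
    · intro i'
      rw [← hκe i', ← h5 i']
      split_ifs <;> omega
    · intro t
      have hb := hρe i
      have hc := hκe j
      rw [if_pos rfl] at hb hc
      rw [pivot_step ψ hψ D i j hD ρ κ R t M M1 r s hbr hbs hrρ hsκ hM1
        (by intro m hm; by_contra hc; exact hm (hM.2.1 _ _ _ hc hne))
        (by intro m hm; by_contra hc; exact hm (hM.2.2 _ _ _ hc hne))
        (by intro k m hk hm; simp [hM1d, hk]), h6, h6, ← hb, ← hc, Tv]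
      have n1 : ((blkc blk (ρ.erase r) i + 1 : ℕ) : ℤ) - (k + 1 : ℕ) - x = (blkc blk (ρ.erase r) i : ℤ) - k - x := by
        push_cast; ring
      have n2 : ((blkc blk (κ.erase s) j + 1 : ℕ) : ℤ) - (k + 1 : ℕ) - y = (blkc blk (κ.erase s) j : ℤ) - k - y := by
        push_cast; ring
      rw [n1, n2]
      have n3 : t - 1 - (R i j + x) = t - (R i j + x) - 1 := by ring
      rw [n3]
      set W := Wsum blk ψ (D.erase (i, j)) ρ' κ' R M'
      set T1 := Tv (Fintype.card F) ((blkc blk (ρ.erase r) i : ℤ) - k - x).toNat ((blkc blk (κ.erase s) j : ℤ) - k - y).toNat k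
            (t - (R i j + x))
      set T2 := Tv (Fintype.card F) ((blkc blk (ρ.erase r) i : ℤ) - k - x).toNat ((blkc blk (κ.erase s) j : ℤ) - k - y).toNat k
            (t - (R i j + x) - 1)
      set E1 : ℤ := (k : ℤ) * R i (j + 1) + blkc blk (ρ.erase r) i * y + blkc blk (κ.erase s) j * x - x * y with hE1
      have n4 : ((k + 1 : ℕ) : ℤ) * R i (j + 1) + ((blkc blk (ρ.erase r) i + 1 : ℕ) : ℤ) * y +
          ((blkc blk (κ.erase s) j + 1 : ℕ) : ℤ) * x - x * y = E1 + (R i j + x) := by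
        rw [hE1, hy]; push_cast; ring
      rw [n4]
      have n5 : (Fintype.card F : ℂ) ^ t = (Fintype.card F : ℂ) ^ (R i j + x) * (Fintype.card F : ℂ) ^ (t - (R i j + x)) := by
        rw [← zpow_add₀ hq]; congr 1; ring
      have n6 : (Fintype.card F : ℂ) ^ (t - 1) = (Fintype.card F : ℂ) ^ (R i j + x) * (Fintype.card F : ℂ) ^ (t - (R i j + x) - 1) := by
        rw [← zpow_add₀ hq]; congr 1; ring
      rw [n5, n6, zpow_add₀ hq E1]
      ring

lemma Wsum_eq_W2 (ψ : AddChar F ℂ) (D : Finset (Fin l × Fin l)) (hU : UpR D) (i j : Fin l)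
    (hD : Corner D i j) (R : ℕ → ℕ → ℤ) (ρ κ : Finset (Fin N)) (M : Matrix (Fin N) (Fin N) F) :
    Wsum blk ψ D ρ κ R M = W2 blk ψ D i j ρ κ R (R (i + 1) j) M := by
  unfold Wsum W2
  apply Finset.sum_congr rfl
  intro Z _
  have hij : (i, j) ∈ D := (hD.1 j).2 le_rfl
  have hil := i.2
  have hjl := j.2
  have : Cond blk D R Z ↔ Cond blk (D.erase (i, j)) R Z ∧
    ((cor blk ((i : ℕ) + 1) j Z).rank : ℤ) = R (i + 1) j := by
    constructor
    · intro h
      constructor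
      · intro a b ha hb hr
        exact h a b ha hb (fun i' j' h1 h2 => Finset.mem_of_mem_erase (hr i' j' h1 h2))
      · refine h _ _ (by omega) (by omega) ?_
        intro i' j' hi' hj'
        exact hU i i' j j' hij (by rw [Fin.le_def]; omega) hj'
    · rintro ⟨h1, h2⟩ a b ha hb hr
      by_cases hab : a ≤ i ∨ (j : ℕ) < b
      · apply h1 a b ha hb
        intro i' j' hi' hj'
        refine Finset.mem_erase.2 ⟨?_, hr i' j' hi' hj'⟩
        intro h
        have e1 : i' = i := congrArg Prod.fst h
        have e2 : j' = j := congrArg Prod.snd h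
        rw [e1] at hi'; rw [e2] at hj'
        omega
      · push Not at hab
        have ea : a = i + 1 := by
          by_contra hne
          have := (hD.2 _).1 (hr ⟨i + 1, by omega⟩ j (by simp; omega) hab.2)
          rw [Fin.le_def] at this
          simp at this
        have eb : b = j := by
          by_contra hne
          have := (hD.1 _).1 (hr i ⟨b, by omega⟩ hab.1 (by simp))
          rw [Fin.le_def] at this
          simp at this
          omega
        rw [ea, eb]; exact h2
  simp only [this]

lemma exists_corner (D : Finset (Fin l × Fin l)) (hU : UpR D) (hne : D.Nonempty) : ∃ i j, Corner D i j := by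
  obtain ⟨p, hp, hmax⟩ := Finset.exists_max_image D Prod.fst hne
  have hne2 : (D.filter fun x => x.1 = p.1).Nonempty := ⟨p, by simp [hp]⟩
  obtain ⟨p', hp', hmin⟩ := Finset.exists_min_image _ Prod.snd hne2
  rw [Finset.mem_filter] at hp'
  have h0 : (p.1, p'.2) ∈ D := by rw [← hp'.2]; exact hp'.1
  refine ⟨p.1, p'.2, ?_, ?_⟩
  · intro k
    constructor
    · intro h; exact hmin (p.1, k) (by simp [h])
    · intro h; exact hU _ _ _ _ h0 le_rfl h
  · intro k
    constructor
    · intro h; exact hmax _ h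
    · intro h; exact hU _ _ _ _ h0 h le_rfl

lemma upR_erase (D : Finset (Fin l × Fin l)) (hU : UpR D) (i j : Fin l) (hD : Corner D i j) : UpR (D.erase (i, j)) := by
  intro i1 i2 j1 j2 h1 h2 h3
  rw [Finset.mem_erase] at h1 ⊢
  refine ⟨?_, hU _ _ _ _ h1.2 h2 h3⟩
  intro h
  have e1 : i2 = i := congrArg Prod.fst h
  have e2 : j2 = j := congrArg Prod.snd h
  subst e1; subst e2
  have a1 : i1 ≤ i2 := (hD.2 _).1 (hU _ _ _ _ h1.2 le_rfl h3)
  have a2 : i1 = i2 := le_antisymm a1 h2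
  subst a2
  have a3 : j2 ≤ j1 := (hD.1 _).1 h1.2
  exact h1.1 (by rw [le_antisymm h3 a3])

def Rl (lam : Fin l → Fin l → ℕ) (a b : ℕ) : ℤ :=
  ∑ i : Fin l, ∑ j : Fin l, if (i : ℕ) < a ∧ b ≤ (j : ℕ) then (lam i j : ℤ) else 0

lemma Rl_row (lam : Fin l → Fin l → ℕ) (i : Fin l) (b : ℕ) :
    Rl lam (i + 1) b - Rl lam i b = ∑ m ∈ Finset.univ.filter (fun m : Fin l => b ≤ (m : ℕ)), (lam i m : ℤ) := by
  unfold Rl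
  rw [← Finset.sum_sub_distrib, Finset.sum_eq_single i]
  · rw [← Finset.sum_sub_distrib, Finset.sum_filter]
    apply Finset.sum_congr rfl
    intro m _
    simp
  · intro k _ hk
    rw [← Finset.sum_sub_distrib]
    apply Finset.sum_eq_zero
    intro m _
    have : (k : ℕ) < i + 1 ↔ (k : ℕ) < i := by
      have : (k : ℕ) ≠ i := fun h => hk (Fin.ext h)
      omega
    simp [this]
  · simp

lemma Rl_col (lam : Fin l → Fin l → ℕ) (a : ℕ) (j : Fin l) :
    Rl lam a j - Rl lam a (j + 1) = ∑ m ∈ Finset.univ.filter (fun m : Fin l => (m : ℕ) < a), (lam m j : ℤ) := by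
  unfold Rl
  rw [← Finset.sum_sub_distrib, Finset.sum_filter]
  apply Finset.sum_congr rfl
  intro k _
  rw [← Finset.sum_sub_distrib, Finset.sum_eq_single j]
  · by_cases h : (k : ℕ) < a <;> simp [h]
  · intro m _ hm
    have : (j : ℕ) ≤ m ↔ (j : ℕ) + 1 ≤ m := by
      have : (m : ℕ) ≠ j := fun h => hm (Fin.ext h)
      omega
    simp [this]
  · simp

def expE (β : Fin l → ℕ) (lam mu : Fin l → Fin l → ℕ) (i j : Fin l) : ℤ :=
  (mu i j : ℤ) * Rl lam i (j + 1)
   + ((β i : ℤ) - ∑ k ∈ Finset.univ.filter (fun k => k < j), (mu i k : ℤ)) *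
       ∑ h ∈ Finset.univ.filter (fun h => h < i), (lam h j : ℤ)
   + ((β j : ℤ) - ∑ k ∈ Finset.univ.filter (fun k => i < k), (mu k j : ℤ)) *
       ∑ m ∈ Finset.univ.filter (fun m => j < m), (lam i m : ℤ)
   - (∑ m ∈ Finset.univ.filter (fun m => j < m), (lam i m : ℤ)) *
       ∑ h ∈ Finset.univ.filter (fun h => h < i), (lam h j : ℤ)

lemma Wsum_main (ψ : AddChar F ℂ) (hψ : ψ ≠ 1) (β : Fin l → ℕ) (lam mu : Fin l → Fin l → ℕ) :
    ∀ (n : ℕ) (D : Finset (Fin l × Fin l)), D.card = n → UpR D →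
      ∀ (ρ κ : Finset (Fin N)) (M : Matrix (Fin N) (Fin N) F), IsPPM M → Supp blk D ρ κ M →
      (∀ i j, (i, j) ∈ D → (ones blk M i j).card = mu i j) →
      (∀ i, blkc blk ρ i + ∑ k ∈ Finset.univ.filter (fun k => (i, k) ∉ D), mu i k = β i) →
      (∀ j, blkc blk κ j + ∑ k ∈ Finset.univ.filter (fun k => (k, j) ∉ D), mu k j = β j) →
      Wsum blk ψ D ρ κ (Rl lam) M = ∏ p ∈ D, ((Fintype.card F : ℂ) ^ expE β lam mu p.1 p.2 *
        Tv (Fintype.card F) (locR β lam mu p.1 p.2 - mu p.1 p.2).toNat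
          (locC β lam mu p.1 p.2 - mu p.1 p.2).toNat (mu p.1 p.2) (lam p.1 p.2)) := by
  intro n
  induction n with
  | zero =>
    intro D hD hU ρ κ M hM hS h1 h2 h3
    rw [Finset.card_eq_zero] at hD
    subst hD
    rw [Finset.prod_empty]
    unfold Wsum
    rw [Finset.sum_eq_single 0]
    · rw [if_pos, pair]
      · simp
      · constructor
        · intro r s h; simp at h
        · intro a b ha hb hr
          have e0 : cor blk a b (0 : Matrix (Fin N) (Fin N) F) = 0 := by ext r s; simp [cor]
          rw [e0, Matrix.rank_zero]
          unfold Rl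
          symm
          apply Finset.sum_eq_zero; intro i _
          apply Finset.sum_eq_zero; intro j _
          rw [if_neg]
          rintro ⟨h1, h2⟩
          have := hr i j h1 h2
          simp at this
    · intro Z _ hZ
      rw [if_neg]
      rintro ⟨h, -⟩
      apply hZ
      ext r s
      by_contra hc
      have := (h r s hc).2.2
      simp at this
    · simp
  | succ n ih =>
    intro D hD hU ρ κ M hM hS h1 h2 h3
    obtain ⟨i, j, hC⟩ := exists_corner D hU (Finset.card_pos.1 (by omega))
    have hij : (i, j) ∈ D := (hC.1 j).2 le_rfl
    rw [Wsum_eq_W2 ψ D hU i j hC]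
    obtain ⟨ρ', κ', M', g1, g2, g3, g4, g5, g6⟩ := combined ψ hψ D hU i j hC (Rl lam) _ _ rfl rfl
      (mu i j) ρ κ M hM hS (h1 i j hij)
    rw [g6, ih (D.erase (i, j)) (by rw [Finset.card_erase_of_mem hij, hD]; rfl) (upR_erase D hU i j hC) ρ' κ' M' g1 g2,
      ← Finset.mul_prod_erase D _ hij]
    · have hx := Rl_row lam i (j + 1)
      have hy := Rl_col lam i j
      have hbR : (blkc blk ρ i : ℤ) = (β i : ℤ) - ∑ k ∈ Finset.univ.filter (fun k => k < j), (mu i k : ℤ) := by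
        have e : (Finset.univ.filter fun k => (i, k) ∉ D) = Finset.univ.filter (fun k => k < j) := by
          ext k; simp [hC.1 k]
        rw [← h2 i, e]; push_cast; ring
      have hcR : (blkc blk κ j : ℤ) = (β j : ℤ) - ∑ k ∈ Finset.univ.filter (fun k => i < k), (mu k j : ℤ) := by
        have e : (Finset.univ.filter fun k => (k, j) ∉ D) = Finset.univ.filter (fun k => i < k) := by
          ext k; simp [hC.2 k]
        rw [← h3 j, e]; push_cast; ring
      have ht : Rl lam (i + 1) j - (Rl lam i j + (Rl lam (i + 1) (j + 1) - Rl lam i (j + 1))) = lam i j := by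
        have a1 := Rl_row lam i j
        have e : (Finset.univ.filter fun m : Fin l => (j : ℕ) ≤ m) =
            insert j (Finset.univ.filter fun m : Fin l => (j : ℕ) + 1 ≤ m) := by
          ext m
          simp only [Finset.mem_filter, Finset.mem_univ, true_and, Finset.mem_insert, Fin.ext_iff]
          omega
        rw [e, Finset.sum_insert (by simp)] at a1
        linarith
      have fx : (Finset.univ.filter fun m : Fin l => (j : ℕ) + 1 ≤ m) = Finset.univ.filter fun m : Fin l => j < m := by
        ext m
        simp only [Finset.mem_filter, Finset.mem_univ, true_and, Fin.lt_def]
        omega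
      have fy : (Finset.univ.filter fun m : Fin l => (m : ℕ) < i) = Finset.univ.filter fun m : Fin l => m < i := by
        ext m
        simp only [Finset.mem_filter, Finset.mem_univ, true_and, Fin.lt_def]
      rw [fx] at hx
      rw [fy] at hy
      rw [ht, hx, hy, hbR, hcR]
      have n1 : ∀ S T : ℤ, (β i : ℤ) - S - mu i j - T = (β i : ℤ) - S - T - mu i j := by intros; ring
      have n2 : ∀ S T : ℤ, (β j : ℤ) - S - mu i j - T = (β j : ℤ) - S - T - mu i j := by intros; ring
      simp only [expE, locR, locC, n1, n2]
    · intro i' j' h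
      rw [Finset.mem_erase] at h
      rw [g3 i' j' h.1]
      exact h1 _ _ h.2
    · intro i'
      rw [← h2 i', ← g4 i']
      by_cases hi : i' = i
      · subst hi
        have e : (Finset.univ.filter fun k => (i', k) ∉ D.erase (i', j)) = insert j (Finset.univ.filter fun k => (i', k) ∉ D) := by
          ext k
          simp only [Finset.mem_filter, Finset.mem_univ, true_and, Finset.mem_insert, Finset.mem_erase, ne_eq, Prod.mk.injEq]
          tauto
        rw [e, Finset.sum_insert (by simp [hij])]
        simp; ring
      · have e : (Finset.univ.filter fun k => (i', k) ∉ D.erase (i, j)) = (Finset.univ.filter fun k => (i', k) ∉ D) := by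
          ext k
          simp only [Finset.mem_filter, Finset.mem_univ, true_and, Finset.mem_erase, ne_eq, Prod.mk.injEq]
          tauto
        rw [e]; simp [hi]
    · intro i'
      rw [← h3 i', ← g5 i']
      by_cases hi : i' = j
      · subst hi
        have e : (Finset.univ.filter fun k => (k, i') ∉ D.erase (i, i')) = insert i (Finset.univ.filter fun k => (k, i') ∉ D) := by
          ext k
          simp only [Finset.mem_filter, Finset.mem_univ, true_and, Finset.mem_insert, Finset.mem_erase, ne_eq, Prod.mk.injEq]
          tauto
        rw [e, Finset.sum_insert (by simp [hij])]
        simp; ring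
      · have e : (Finset.univ.filter fun k => (k, i') ∉ D.erase (i, j)) = (Finset.univ.filter fun k => (k, i') ∉ D) := by
          ext k
          simp only [Finset.mem_filter, Finset.mem_univ, true_and, Finset.mem_erase, ne_eq, Prod.mk.injEq]
          tauto
        rw [e]; simp [hi]

end combined

section orbits
open Module Submodule Matrix
variable {F : Type} [Field F] {N l : ℕ} {blk : Fin N → Fin l}

def LTm (blk : Fin N → Fin l) (g : Matrix (Fin N) (Fin N) F) : Prop :=
  IsUnit g ∧ ∀ r s, blk r < blk s → g r s = 0

lemma LTm_one : LTm blk (1 : Matrix (Fin N) (Fin N) F) :=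
  ⟨isUnit_one, fun r s h => Matrix.one_apply_ne (fun e => by subst e; exact lt_irrefl _ h)⟩

lemma LTm_mul {g h : Matrix (Fin N) (Fin N) F} (hg : LTm blk g) (hh : LTm blk h) : LTm blk (g * h) := by
  refine ⟨hg.1.mul hh.1, fun r s hrs => ?_⟩
  rw [Matrix.mul_apply]
  apply Finset.sum_eq_zero
  intro a _
  by_cases h1 : blk r < blk a
  · rw [hg.2 _ _ h1, zero_mul]
  · rw [hh.2 a s (lt_of_le_of_lt (not_lt.1 h1) hrs), mul_zero]

lemma LTm_inv {g : Matrix (Fin N) (Fin N) F} (hg : LTm blk g) :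
    ∃ h, LTm blk h ∧ h * g = 1 ∧ g * h = 1 := by
  have hd : IsUnit g.det := (Matrix.isUnit_iff_isUnit_det g).1 hg.1
  haveI := hg.1.invertible
  refine ⟨g⁻¹, ⟨?_, ?_⟩, Matrix.nonsing_inv_mul g hd, Matrix.mul_nonsing_inv g hd⟩
  · exact (Matrix.isUnit_nonsing_inv_iff).2 hg.1
  · have h1 : Matrix.BlockTriangular g (fun r => OrderDual.toDual (blk r)) := fun r s h => hg.2 r s h
    have h2 := Matrix.blockTriangular_inv_of_blockTriangular h1
    exact fun r s h => h2 h

lemma trunc_ap (R : Fin N → Fin N → Prop) (Y : Matrix (Fin N) (Fin N) F) (r s : Fin N) :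
    trunc R Y r s = if R r s then Y r s else 0 := rfl

lemma cor_ap (a b : ℕ) (Y : Matrix (Fin N) (Fin N) F) (r s : Fin N) :
    cor blk a b Y r s = if (blk r : ℕ) < a ∧ b ≤ (blk s : ℕ) then Y r s else 0 := rfl

lemma trunc_mul {D : Finset (Fin l × Fin l)} (hU : UpR D) {P : Fin l → Fin l → Prop}
    (hD : ∀ i j, (i, j) ∈ D ↔ P i j)
    (g h Y : Matrix (Fin N) (Fin N) F) (hg : ∀ r s, blk r < blk s → g r s = 0)
    (hh : ∀ r s, blk r < blk s → h r s = 0) :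
    trunc (fatR blk P) (g * trunc (fatR blk P) Y * h) = trunc (fatR blk P) (g * Y * h) := by
  ext r s
  rw [trunc_ap, trunc_ap]
  split_ifs with hrs
  · rw [Matrix.mul_apply, Matrix.mul_apply]
    apply Finset.sum_congr rfl
    intro b _
    rw [Matrix.mul_apply, Matrix.mul_apply, Finset.sum_mul, Finset.sum_mul]
    apply Finset.sum_congr rfl
    intro a _
    by_cases h1 : blk r < blk a
    · rw [hg _ _ h1]; simp
    by_cases h2 : blk b < blk s
    · rw [hh _ _ h2]; simp
    rw [trunc_ap, if_pos]
    exact (hD _ _).1 (hU _ _ _ _ ((hD _ _).2 hrs) (not_lt.1 h1) (not_lt.1 h2))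
  · rfl

lemma rank_cor_le {D : Finset (Fin l × Fin l)} {P : Fin l → Fin l → Prop}
    (hD : ∀ i j, (i, j) ∈ D ↔ P i j)
    (g h Y : Matrix (Fin N) (Fin N) F) (hg : ∀ r s, blk r < blk s → g r s = 0)
    (hh : ∀ r s, blk r < blk s → h r s = 0) (a b : ℕ) (hab : rectIn D a b) :
    (cor blk a b (trunc (fatR blk P) (g * Y * h))).rank ≤ (cor blk a b Y).rank := by
  have key : cor blk a b (trunc (fatR blk P) (g * Y * h)) =
      cor blk a 0 g * cor blk a b Y * cor blk l b h := by
    ext r s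
    rw [Matrix.mul_apply]
    simp only [Matrix.mul_apply]
    simp only [cor_ap, trunc_ap]
    by_cases hrs : (blk r : ℕ) < a ∧ b ≤ (blk s : ℕ)
    · rw [if_pos hrs]
      have : fatR blk P r s := (hD _ _).1 (hab _ _ hrs.1 hrs.2)
      rw [if_pos this, Matrix.mul_apply]
      apply Finset.sum_congr rfl
      intro c _
      rw [Matrix.mul_apply, Finset.sum_mul, Finset.sum_mul]
      apply Finset.sum_congr rfl
      intro d _
      by_cases h1 : blk r < blk d
      · rw [hg _ _ h1]; simp
      by_cases h2 : blk c < blk s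
      · rw [hh _ _ h2]; simp
      have e1 : (blk d : ℕ) < a := lt_of_le_of_lt (not_lt.1 h1) hrs.1
      have e2 : b ≤ (blk c : ℕ) := le_trans hrs.2 (not_lt.1 h2)
      simp [e1, e2, hrs]
    · rw [if_neg hrs]
      symm
      apply Finset.sum_eq_zero
      intro c _
      by_cases h1 : (blk r : ℕ) < a
      · have : ¬ b ≤ (blk s : ℕ) := fun h => hrs ⟨h1, h⟩
        simp [this]
      · simp [h1]
  rw [key]
  exact (Matrix.rank_mul_le_left _ _).trans (Matrix.rank_mul_le_right _ _)

lemma trunc_self {P : Fin l → Fin l → Prop} (Y : Matrix (Fin N) (Fin N) F)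
    (hY : ∀ r s, ¬ fatR blk P r s → Y r s = 0) : trunc (fatR blk P) Y = Y := by
  ext r s
  unfold trunc
  split_ifs with h
  · rfl
  · exact (hY r s h).symm

lemma rank_ppm {m n : Type} [Fintype m] [Fintype n] (A : Matrix m n F)
    (h1 : ∀ r s, A r s = 0 ∨ A r s = 1) (h2 : ∀ r s t, A r s ≠ 0 → A r t ≠ 0 → s = t)
    (h3 : ∀ r s t, A r t ≠ 0 → A s t ≠ 0 → r = s) :
    A.rank = (Finset.univ.filter fun p : m × n => A p.1 p.2 ≠ 0).card := by
  rw [Matrix.rank_eq_finrank_span_cols]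
  have hs : span F (Set.range A.col) = span F (Set.range fun p : {p : m × n // A p.1 p.2 ≠ 0} => (Pi.single p.1.1 1 : m → F)) := by
    have hcol : ∀ p : m × n, A p.1 p.2 ≠ 0 → A.col p.2 = Pi.single p.1 1 := by
      intro p hp
      ext r
      by_cases hr : r = p.1
      · subst hr; simpa using (h1 _ _).resolve_left hp
      · rw [Pi.single_eq_of_ne hr]
        by_contra hc
        exact hr (h3 _ _ _ hc hp)
    apply le_antisymm
    · rw [span_le]
      rintro _ ⟨s, rfl⟩
      by_cases hz : ∃ r, A r s ≠ 0
      · obtain ⟨r, hr⟩ := hz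
        apply subset_span
        exact ⟨⟨(r, s), hr⟩, (hcol (r, s) hr).symm⟩
      · push Not at hz
        have : A.col s = 0 := by ext r; exact hz r
        rw [this]; exact zero_mem _
    · rw [span_le]
      rintro _ ⟨p, rfl⟩
      apply subset_span
      exact ⟨p.1.2, hcol p.1 p.2⟩
  rw [hs, finrank_span_eq_card, Fintype.card_subtype]
  have := (Pi.basisFun F m).linearIndependent
  have h4 := this.comp (fun p : {p : m × n // A p.1 p.2 ≠ 0} => p.1.1) (by
    rintro ⟨⟨r, s⟩, hp⟩ ⟨⟨r', s'⟩, hp'⟩ h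
    dsimp at h
    subst h
    exact Subtype.ext (Prod.ext rfl (h2 _ _ _ hp hp')))
  convert h4 using 1
  ext p r
  simp [Pi.basisFun_apply]

lemma blockRank_ppm (Y : Matrix (Fin N) (Fin N) F) (hY : IsPPM Y) (i j : Fin l) :
    blockRank blk Y i j = (ones blk Y i j).card := by
  unfold blockRank
  rw [rank_ppm]
  · apply Finset.card_bij (fun p _ => ((p.1 : Fin N), (p.2 : Fin N)))
    · rintro ⟨⟨r, hr⟩, ⟨s, hs⟩⟩ h
      simpa [ones, hr, hs] using (Finset.mem_filter.1 h).2
    · rintro ⟨⟨r, hr⟩, ⟨s, hs⟩⟩ h ⟨⟨r', hr'⟩, ⟨s', hs'⟩⟩ h' e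
      simpa using e
    · rintro ⟨r, s⟩ h
      simp only [ones, Finset.mem_filter, Finset.mem_univ, true_and] at h
      exact ⟨(⟨r, h.1⟩, ⟨s, h.2.1⟩), Finset.mem_filter.2 ⟨Finset.mem_univ _, h.2.2⟩, rfl⟩
  · intro r s; exact hY.1 _ _
  · intro r s t h h'; exact Subtype.ext (hY.2.1 _ _ _ h h')
  · intro r s t h h'; exact Subtype.ext (hY.2.2 _ _ _ h h')

lemma rank_cor_ppm (Y : Matrix (Fin N) (Fin N) F) (hY : IsPPM Y) (a b : ℕ) :
    ((cor blk a b Y).rank : ℤ) = Rl (fun i j => (ones blk Y i j).card) a b := by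
  have hne : ∀ r s, cor blk a b Y r s ≠ 0 → Y r s ≠ 0 := by
    intro r s h hc; apply h; unfold cor; simp [hc]
  rw [rank_ppm]
  · rw [Finset.card_eq_sum_card_fiberwise (f := fun p => (blk p.1, blk p.2)) (t := Finset.univ) (by simp)]
    rw [← Finset.univ_product_univ, Finset.sum_product]
    unfold Rl
    push_cast
    apply Finset.sum_congr rfl; intro i _
    apply Finset.sum_congr rfl; intro j _
    rw [Finset.filter_filter]
    split_ifs with h
    · congr 2
      ext p
      simp only [ones, cor, Finset.mem_filter, Finset.mem_univ, true_and, Prod.mk.injEq]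
      constructor
      · rintro ⟨h1, h2, h3⟩
        refine ⟨h2, h3, fun hc => h1 ?_⟩
        simp [hc]
      · rintro ⟨h1, h2, h3⟩
        refine ⟨?_, h1, h2⟩
        rw [h1, h2, if_pos h]; exact h3
    · rw [Nat.cast_eq_zero, Finset.card_eq_zero, Finset.filter_eq_empty_iff]
      rintro p _ ⟨h1, h2⟩
      rw [Prod.mk.injEq] at h2
      apply h1
      unfold cor
      rw [h2.1, h2.2, if_neg h]
  · intro r s; unfold cor; split_ifs
    · exact hY.1 _ _
    · left; rfl
  · intro r s t h h'; exact hY.2.1 _ _ _ (hne _ _ h) (hne _ _ h')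
  · intro r s t h h'; exact hY.2.2 _ _ _ (hne _ _ h) (hne _ _ h')

lemma isUnit_add_vec (v w : Fin N → F) (h : 1 + w ⬝ᵥ v ≠ 0) :
    IsUnit (1 + vecMulVec v w : Matrix (Fin N) (Fin N) F) := by
  rw [Matrix.isUnit_iff_isUnit_det, isUnit_iff_ne_zero, vecMulVec_eq Unit, Matrix.det_one_add_replicateCol_mul_replicateRow]
  exact h

def InvK (k : ℕ) (Z : Matrix (Fin N) (Fin N) F) : Prop :=
  ∀ r : Fin N, (r : ℕ) < k → ∀ s, Z r s ≠ 0 → Z r s = 1 ∧ (∀ t, t ≠ s → Z r t = 0) ∧ ∀ t, t ≠ r → Z t s = 0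

lemma elim_step (hblk : Monotone blk) (k : Fin N) (Z : Matrix (Fin N) (Fin N) F) (hZ : InvK k Z) :
    ∃ g h, LTm blk g ∧ LTm blk h ∧ InvK (k + 1) (g * Z * h) := by
  by_cases hk : ∀ s, Z k s = 0
  · refine ⟨1, 1, LTm_one, LTm_one, ?_⟩
    rw [one_mul, mul_one]
    intro r hr s hs
    rcases Nat.lt_succ_iff_lt_or_eq.1 hr with h | h
    · exact hZ r h s hs
    · exact absurd (Fin.ext h ▸ hk s) hs
  push Not at hk
  obtain ⟨s, hs, hmax⟩ : ∃ s, Z k s ≠ 0 ∧ ∀ t, s < t → Z k t = 0 := by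
    have hne : (Finset.univ.filter fun s => Z k s ≠ 0).Nonempty := by
      obtain ⟨s, hs⟩ := hk; exact ⟨s, by simp [hs]⟩
    refine ⟨_, (Finset.mem_filter.1 (Finset.max'_mem _ hne)).2, fun t ht => ?_⟩
    by_contra hc
    exact absurd (Finset.le_max' _ t (by simp [hc])) (not_le.2 ht)
  have hup : ∀ r, r < k → Z r s = 0 := by
    intro r hr
    by_contra hc
    exact hs ((hZ r hr s hc).2.2 k (ne_of_gt hr))
  set x := Z k s with hx
  let v : Fin N → F := fun r => if r = k then x⁻¹ - 1 else - Z r s / x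
  let w : Fin N → F := fun t => if t = s then 0 else - Z k t / x
  have hfin : ∀ r t, ((1 + vecMulVec v (Pi.single k 1)) * Z * (1 + vecMulVec (Pi.single s 1) w)) r t =
      if r = k then (if t = s then 1 else 0) else Z r t - Z r s * Z k t / x := by
    intro r t
    have e1 : ∀ r t, ((1 + vecMulVec v (Pi.single k 1)) * Z) r t = Z r t + v r * Z k t := by
      intro r t
      rw [add_mul, one_mul, Matrix.add_apply, vecMulVec_mul, vecMulVec_apply, single_one_vecMul]
      rfl
    rw [mul_add, mul_one, Matrix.add_apply, mul_vecMulVec, vecMulVec_apply, mulVec_single_one]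
    show _ + ((1 + vecMulVec v (Pi.single k 1)) * Z) r s * w t = _
    rw [e1, e1]
    simp only [v, w]
    by_cases hr : r = k
    · subst hr
      by_cases ht : t = s
      · subst ht; simp only [if_true, ← hx]; field_simp; ring
      · simp only [if_true, if_neg ht, ← hx]; field_simp; ring
    · simp only [if_neg hr, ← hx]; field_simp; split_ifs <;> ring
  refine ⟨_, _, ⟨isUnit_add_vec v (Pi.single k 1) ?_, ?_⟩, ⟨isUnit_add_vec (Pi.single s 1) w ?_, ?_⟩, ?_⟩
  · simp [v, hs]
  · intro r t hrt
    have hlt : r < t := lt_of_not_ge fun h => absurd (hblk h) (not_le.2 hrt)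
    rw [Matrix.add_apply, Matrix.one_apply_ne (ne_of_lt hlt), vecMulVec_apply]
    by_cases ht : t = k
    · subst ht
      simp [v, ne_of_lt hlt, hup r hlt]
    · simp [Pi.single_eq_of_ne ht]
  · simp [w]
  · intro r t hrt
    have hlt : r < t := lt_of_not_ge fun h => absurd (hblk h) (not_le.2 hrt)
    rw [Matrix.add_apply, Matrix.one_apply_ne (ne_of_lt hlt), vecMulVec_apply]
    by_cases ht : r = s
    · subst ht
      simp [w, hmax t hlt]
    · simp [Pi.single_eq_of_ne ht]
  · intro r hr t ht
    rw [hfin] at ht ⊢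
    simp only [hfin]
    rcases Nat.lt_succ_iff_lt_or_eq.1 hr with h | h
    · have hrk : r ≠ k := fun e => by subst e; exact lt_irrefl _ h
      have hrs := hup r h
      simp only [if_neg hrk, hrs, zero_mul, zero_div, sub_zero] at ht ⊢
      obtain ⟨z1, z2, z3⟩ := hZ r h t ht
      refine ⟨z1, z2, fun u hu => ?_⟩
      have hts : t ≠ s := fun e => by subst e; exact ht hrs
      rw [z3 u hu, z3 k hrk.symm]
      simp [hts]
    · have hrk : r = k := Fin.ext h
      subst hrk
      simp only [if_true] at ht ⊢
      have hts : t = s := by by_contra hc; simp [hc] at ht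
      subst hts
      refine ⟨by simp, fun u hu => by simp [hu], fun u hu => ?_⟩
      rw [if_neg hu, ← hx]; field_simp; ring

lemma elim_all (hblk : Monotone blk) (Z : Matrix (Fin N) (Fin N) F) :
    ∀ k, k ≤ N → ∃ g h, LTm blk g ∧ LTm blk h ∧ InvK k (g * Z * h) := by
  intro k
  induction k with
  | zero => intro _; exact ⟨1, 1, LTm_one, LTm_one, fun r hr => absurd hr (Nat.not_lt_zero _)⟩
  | succ k ih =>
    intro hk
    obtain ⟨g, h, hg, hh, hI⟩ := ih (by omega)
    obtain ⟨g', h', hg', hh', hI'⟩ := elim_step hblk ⟨k, hk⟩ (g * Z * h) hI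
    refine ⟨g' * g, h * h', LTm_mul hg' hg, LTm_mul hh hh', ?_⟩
    have : g' * g * Z * (h * h') = g' * (g * Z * h) * h' := by simp only [mul_assoc]
    rw [this]; exact hI'

lemma exists_ppm (hblk : Monotone blk) (Z : Matrix (Fin N) (Fin N) F) :
    ∃ g h, LTm blk g ∧ LTm blk h ∧ IsPPM (g * Z * h) := by
  obtain ⟨g, h, hg, hh, hI⟩ := elim_all hblk Z N le_rfl
  refine ⟨g, h, hg, hh, ?_, ?_, ?_⟩
  · intro r s
    by_cases hz : (g * Z * h) r s = 0
    · exact Or.inl hz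
    · exact Or.inr (hI r r.2 s hz).1
  · intro r s t h1 h2
    by_contra hc
    exact h2 ((hI r r.2 s h1).2.1 t (Ne.symm hc))
  · intro r s t h1 h2
    by_contra hc
    exact h2 ((hI r r.2 t h1).2.2 s (Ne.symm hc))

lemma trunc_ppm {R : Fin N → Fin N → Prop} (Y : Matrix (Fin N) (Fin N) F) (hY : IsPPM Y) :
    IsPPM (trunc R Y) := by
  have hne : ∀ r s, trunc R Y r s ≠ 0 → Y r s ≠ 0 := by
    intro r s h hc; apply h; unfold trunc; simp [hc]
  refine ⟨?_, ?_, ?_⟩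
  · intro r s; unfold trunc; split_ifs
    · exact hY.1 _ _
    · left; rfl
  · intro r s t h h'; exact hY.2.1 _ _ _ (hne _ _ h) (hne _ _ h')
  · intro r s t h h'; exact hY.2.2 _ _ _ (hne _ _ h) (hne _ _ h')

end orbits

section orbits2
open Module Submodule Matrix
variable {F : Type} [Field F] {N l : ℕ} {blk : Fin N → Fin l}

lemma perm_fib {γ : Type} (f g : Fin N → γ)
    (h : ∀ c, (Finset.univ.filter fun r => f r = c).card = (Finset.univ.filter fun r => g r = c).card) :
    ∃ σ : Equiv.Perm (Fin N), ∀ r, g (σ r) = f r := by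
  have e : ∀ c, Nonempty ({r // f r = c} ≃ {r // g r = c}) := by
    intro c
    apply Fintype.card_eq.1
    rw [Fintype.card_subtype, Fintype.card_subtype]
    exact h c
  exact ⟨Equiv.ofFiberEquiv fun c => (e c).some, fun r => Equiv.ofFiberEquiv_map _ r⟩

lemma perm_opt {γ : Type} [Fintype γ] (blk : Fin N → Fin l) (f g : Fin N → Option γ)
    (h : ∀ i c, (Finset.univ.filter fun r => blk r = i ∧ f r = some c).card =
      (Finset.univ.filter fun r => blk r = i ∧ g r = some c).card) :
    ∃ σ : Equiv.Perm (Fin N), ∀ r, blk (σ r) = blk r ∧ g (σ r) = f r := by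
  have tot : ∀ (f : Fin N → Option γ) (i : Fin l), (Finset.univ.filter fun r => blk r = i).card =
      (Finset.univ.filter fun r => blk r = i ∧ f r = none).card +
        ∑ c, (Finset.univ.filter fun r => blk r = i ∧ f r = some c).card := by
    intro f i
    rw [Finset.card_eq_sum_card_fiberwise (f := f) (t := Finset.univ) (by simp), Fintype.sum_option]
    simp only [Finset.filter_filter]
  obtain ⟨σ, hσ⟩ := perm_fib (fun r => (blk r, f r)) (fun r => (blk r, g r)) (by
    rintro ⟨i, c⟩
    simp only [Prod.mk.injEq]
    cases c with
    | some c => exact h i c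
    | none =>
      have h1 := tot f i
      have h2 := tot g i
      have h3 := Finset.sum_congr (rfl : (Finset.univ : Finset γ) = _) (fun c _ => h i c)
      omega)
  exact ⟨σ, fun r => by simpa [Prod.mk.injEq] using hσ r⟩

def colOf {γ : Type} (Y : Matrix (Fin N) (Fin N) F) (f : Fin N → γ) (r : Fin N) : Option γ :=
  if h : ∃ s, Y r s ≠ 0 then some (f h.choose) else none

lemma colOf_iff {γ : Type} (Y : Matrix (Fin N) (Fin N) F) (hY : IsPPM Y) (f : Fin N → γ) (r : Fin N) (c : γ) :
    colOf Y f r = some c ↔ ∃ s, Y r s ≠ 0 ∧ f s = c := by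
  unfold colOf
  split_ifs with h
  · rw [Option.some_inj]
    constructor
    · intro e; exact ⟨_, h.choose_spec, e⟩
    · rintro ⟨s, hs, rfl⟩
      rw [hY.2.1 _ _ _ hs h.choose_spec]
  · simp only [reduceCtorEq, false_iff]
    rintro ⟨s, hs, -⟩
    exact h ⟨s, hs⟩

lemma transpose_ppm {Y : Matrix (Fin N) (Fin N) F} (hY : IsPPM Y) : IsPPM Yᵀ :=
  ⟨fun r s => hY.1 s r, fun r s t h h' => hY.2.2 _ _ _ h h', fun r s t h h' => hY.2.1 _ _ _ h h'⟩

lemma ppm_perm (Y Λ : Matrix (Fin N) (Fin N) F) (hY : IsPPM Y) (hΛ : IsPPM Λ)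
    (h : ∀ i j, (ones blk Y i j).card = (ones blk Λ i j).card) :
    ∃ σ τ : Equiv.Perm (Fin N), (∀ r, blk (σ r) = blk r) ∧ (∀ r, blk (τ r) = blk r) ∧
      ∀ r s, Y r s = Λ (σ r) (τ s) := by
  have cnt : ∀ X : Matrix (Fin N) (Fin N) F, IsPPM X → ∀ i j,
      (Finset.univ.filter fun r => blk r = i ∧ colOf X blk r = some j).card = (ones blk X i j).card := by
    intro X hX i j
    symm
    apply Finset.card_bij (fun p _ => p.1)
    · intro p hp
      simp only [ones, Finset.mem_filter, Finset.mem_univ, true_and] at hp ⊢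
      exact ⟨hp.1, (colOf_iff X hX blk _ _).2 ⟨p.2, hp.2.2, hp.2.1⟩⟩
    · rintro ⟨r, s⟩ hp ⟨r', s'⟩ hp' e
      simp only [ones, Finset.mem_filter, Finset.mem_univ, true_and] at hp hp' e
      subst e
      rw [hX.2.1 _ _ _ hp.2.2 hp'.2.2]
    · intro r hr
      simp only [ones, Finset.mem_filter, Finset.mem_univ, true_and] at hr
      obtain ⟨s, hs, hj⟩ := (colOf_iff X hX blk _ _).1 hr.2
      exact ⟨(r, s), by simp [ones, hr.1, hs, hj], rfl⟩
  obtain ⟨σ, hσ⟩ := perm_opt blk (colOf Y blk) (colOf Λ blk) (by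
    intro i j; convert h i j using 1 <;> (rw [← cnt _ (by assumption)]; congr!))
  let L : Matrix (Fin N) (Fin N) F := fun r s => Λ (σ r) s
  have hL : IsPPM L := ⟨fun r s => hΛ.1 _ _, fun r s t h h' => hΛ.2.1 _ _ _ h h',
    fun r s t h h' => σ.injective (hΛ.2.2 _ _ _ h h')⟩
  have hex : ∀ r j, (∃ s, Y r s ≠ 0 ∧ blk s = j) ↔ ∃ s, L r s ≠ 0 ∧ blk s = j := by
    intro r j
    rw [← colOf_iff Y hY, ← (hσ r).2, colOf_iff Λ hΛ]
  have cnt2 : ∀ X : Matrix (Fin N) (Fin N) F, IsPPM X → ∀ i r,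
      (Finset.univ.filter fun s => blk s = i ∧ colOf Xᵀ id s = some r).card =
        if ∃ s, X r s ≠ 0 ∧ blk s = i then 1 else 0 := by
    intro X hX i r
    split_ifs with hh
    · obtain ⟨s, hs, hi⟩ := hh
      rw [Finset.card_eq_one]
      refine ⟨s, ?_⟩
      ext t
      simp only [Finset.mem_filter, Finset.mem_univ, true_and, Finset.mem_singleton, colOf_iff _ (transpose_ppm hX)]
      constructor
      · rintro ⟨h1, u, h2, rfl⟩
        exact hX.2.1 _ _ _ h2 hs
      · rintro rfl; exact ⟨hi, r, hs, rfl⟩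
    · rw [Finset.card_eq_zero, Finset.filter_eq_empty_iff]
      rintro t _ ⟨h1, h2⟩
      obtain ⟨u, hu, rfl⟩ := (colOf_iff _ (transpose_ppm hX) _ _ _).1 h2
      exact hh ⟨t, hu, h1⟩
  obtain ⟨τ, hτ⟩ := perm_opt blk (colOf Yᵀ id) (colOf Lᵀ id) (by
    intro i r
    have e := (cnt2 Y hY i r).trans ((by simp only [hex]) : _ = _) |>.trans (cnt2 L hL i r).symm
    convert e using 1 <;> congr!)
  refine ⟨σ, τ, fun r => (hσ r).1, fun r => (hτ r).1, fun r s => ?_⟩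
  have hiff : Y r s ≠ 0 ↔ L r (τ s) ≠ 0 := by
    have a1 := colOf_iff _ (transpose_ppm hY) (id : Fin N → Fin N) s r
    have a2 := colOf_iff _ (transpose_ppm hL) (id : Fin N → Fin N) (τ s) r
    rw [(hτ s).2, a1] at a2
    simpa [Matrix.transpose_apply] using a2
  show Y r s = L r (τ s)
  rcases hY.1 r s with e1 | e1 <;> rcases hL.1 r (τ s) with e2 | e2 <;> simp_all

def pmL (σ : Equiv.Perm (Fin N)) : Matrix (Fin N) (Fin N) F := fun r s => if s = σ r then 1 else 0

def pmR (σ : Equiv.Perm (Fin N)) : Matrix (Fin N) (Fin N) F := fun r s => if r = σ s then 1 else 0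

lemma pmL_mul (σ : Equiv.Perm (Fin N)) (Y : Matrix (Fin N) (Fin N) F) (r s : Fin N) :
    ((pmL σ : Matrix (Fin N) (Fin N) F) * Y) r s = Y (σ r) s := by
  rw [Matrix.mul_apply]
  simp [pmL]

lemma mul_pmR (σ : Equiv.Perm (Fin N)) (Y : Matrix (Fin N) (Fin N) F) (r s : Fin N) :
    (Y * (pmR σ : Matrix (Fin N) (Fin N) F)) r s = Y r (σ s) := by
  rw [Matrix.mul_apply]
  simp [pmR]

lemma pm_one (σ : Equiv.Perm (Fin N)) : ((pmL σ : Matrix (Fin N) (Fin N) F) * (pmR σ : Matrix (Fin N) (Fin N) F) : Matrix (Fin N) (Fin N) F) = 1 := by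
  ext r s
  rw [pmL_mul, Matrix.one_apply]
  simp [pmR]

lemma LTm_perm (σ : Equiv.Perm (Fin N)) (hσ : ∀ r, blk (σ r) = blk r) :
    LTm blk (pmL σ : Matrix (Fin N) (Fin N) F) := by
  refine ⟨IsUnit.of_mul_eq_one _ (pm_one σ), ?_⟩
  intro r s h
  unfold pmL
  rw [if_neg]
  rintro rfl
  rw [hσ] at h
  exact lt_irrefl _ h

lemma LTm_perm' (σ : Equiv.Perm (Fin N)) (hσ : ∀ r, blk (σ r) = blk r) :
    LTm blk (pmR σ : Matrix (Fin N) (Fin N) F) := by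
  refine ⟨IsUnit.of_mul_eq_one _ (mul_eq_one_comm.1 (pm_one σ)), ?_⟩
  intro r s h
  unfold pmR
  rw [if_neg]
  rintro rfl
  rw [hσ] at h
  exact lt_irrefl _ h

lemma perm_mul (σ τ : Equiv.Perm (Fin N)) (Y : Matrix (Fin N) (Fin N) F) (r s : Fin N) :
    ((pmL σ : Matrix (Fin N) (Fin N) F) * Y * (pmR τ : Matrix (Fin N) (Fin N) F)) r s = Y (σ r) (τ s) := by
  rw [mul_pmR, pmL_mul]

lemma Rl_corner (lam : Fin l → Fin l → ℕ) (i j : Fin l) :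
    Rl lam (i + 1) j - (Rl lam i j + (Rl lam (i + 1) (j + 1) - Rl lam i (j + 1))) = lam i j := by
  have a1 := Rl_row lam i j
  have a2 := Rl_row lam i (j + 1)
  have e : (Finset.univ.filter fun m : Fin l => (j : ℕ) ≤ m) =
      insert j (Finset.univ.filter fun m : Fin l => (j : ℕ) + 1 ≤ m) := by
    ext m
    simp only [Finset.mem_filter, Finset.mem_univ, true_and, Finset.mem_insert, Fin.ext_iff]
    omega
  rw [e, Finset.sum_insert (by simp)] at a1
  linarith

lemma orb_iff (hblk : Monotone blk) {D : Finset (Fin l × Fin l)} (hU : UpR D) {P : Fin l → Fin l → Prop}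
    (hD : ∀ i j, (i, j) ∈ D ↔ P i j) (lam : Fin l → Fin l → ℕ)
    (Λ : Matrix (Fin N) (Fin N) F) (hΛ1 : Λ ∈ utAlg F (fatR blk P)) (hΛ2 : IsPPM Λ)
    (hlam : ∀ i j, (ones blk Λ i j).card = lam i j) (Z : Matrix (Fin N) (Fin N) F) :
    Z ∈ orb F blk (fatR blk P) Λ ↔ Supp blk D Finset.univ Finset.univ Z ∧ Cond blk D (Rl lam) Z := by
  have hlam' : (fun i j => (ones blk Λ i j).card) = lam := by ext i j; exact hlam i j
  have tr : ∀ (X g h : Matrix (Fin N) (Fin N) F), LTm blk g → LTm blk h →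
      trunc (fatR blk P) X = X →
      (∀ a b, rectIn D a b →
        (cor blk a b (trunc (fatR blk P) (g * X * h))).rank = (cor blk a b X).rank) ∧
      ∃ g' h', LTm blk g' ∧ LTm blk h' ∧ X = trunc (fatR blk P) (g' * trunc (fatR blk P) (g * X * h) * h') := by
    intro X g h hg hh hX
    obtain ⟨g', hg', e1, -⟩ := LTm_inv hg
    obtain ⟨h', hh', -, e2⟩ := LTm_inv hh
    have key : X = trunc (fatR blk P) (g' * trunc (fatR blk P) (g * X * h) * h') := by
      rw [trunc_mul hU hD g' h' _ hg'.2 hh'.2]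
      have : g' * (g * X * h) * h' = (g' * g) * X * (h * h') := by simp only [mul_assoc]
      rw [this, e1, e2, one_mul, mul_one, hX]
    refine ⟨fun a b hab => le_antisymm (rank_cor_le hD g h X hg.2 hh.2 a b hab) ?_, g', h', hg', hh', key⟩
    conv_lhs => rw [key]
    exact rank_cor_le hD g' h' _ hg'.2 hh'.2 a b hab
  constructor
  · rintro ⟨g, h, u1, u2, l1, l2, rfl⟩
    constructor
    · intro r s hrs
      refine ⟨Finset.mem_univ _, Finset.mem_univ _, ?_⟩
      by_contra hc
      apply hrs
      rw [trunc_ap, if_neg]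
      intro hp; exact hc ((hD _ _).2 hp)
    · intro a b _ _ hab
      rw [(tr Λ g h ⟨u1, l1⟩ ⟨u2, l2⟩ (trunc_self _ hΛ1)).1 a b hab, rank_cor_ppm _ hΛ2, hlam']
  · rintro ⟨hS, hC⟩
    have hZ : trunc (fatR blk P) Z = Z := by
      apply trunc_self
      intro r s h
      by_contra hc
      exact h ((hD _ _).1 (hS r s hc).2.2)
    obtain ⟨g, h, hg, hh, hp⟩ := exists_ppm hblk Z
    obtain ⟨t1, g', h', hg', hh', t2⟩ := tr Z g h hg hh hZ
    set Y := trunc (fatR blk P) (g * Z * h) with hYdef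
    have hY : IsPPM Y := trunc_ppm _ hp
    have hR : ∀ a b, a ≤ l → b ≤ l → rectIn D a b →
        Rl (fun i j => (ones blk Y i j).card) a b = Rl lam a b := by
      intro a b ha hb hab
      rw [← rank_cor_ppm _ hY, t1 a b hab]
      exact hC a b ha hb hab
    have hcnt : ∀ i j, (ones blk Y i j).card = (ones blk Λ i j).card := by
      intro i j
      by_cases hij : (i, j) ∈ D
      · have hr : ∀ a b : ℕ, a ≤ i + 1 → (j : ℕ) ≤ b → rectIn D a b := by
          intro a b ha hb i' j' hi hj
          exact hU i i' j j' hij (by rw [Fin.le_def]; omega) (by rw [Fin.le_def]; omega)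
        have c1 := Rl_corner (fun i j => (ones blk Y i j).card) i j
        have c2 := Rl_corner lam i j
        have hi := i.2
        have hj := j.2
        rw [hR _ _ (by omega) (by omega) (hr _ _ le_rfl le_rfl), hR _ _ (by omega) (by omega) (hr i j (by omega) le_rfl),
          hR _ _ (by omega) (by omega) (hr _ _ le_rfl (by omega)), hR _ _ (by omega) (by omega) (hr i (j+1) (by omega) (by omega)), c2] at c1
        rw [hlam]
        exact_mod_cast c1.symm
      · have em : ∀ X : Matrix (Fin N) (Fin N) F, (∀ r s, ¬ fatR blk P r s → X r s = 0) → (ones blk X i j).card = 0 := by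
          intro X hX
          rw [Finset.card_eq_zero, ones, Finset.filter_eq_empty_iff]
          rintro p _ ⟨h1, h2, h3⟩
          apply h3
          apply hX
          intro hp
          apply hij
          rw [hD, ← h1, ← h2]; exact hp
        rw [em Y, em Λ hΛ1]
        intro r s hrs
        rw [hYdef, trunc_ap, if_neg hrs]
    obtain ⟨σ, τ, hσ, hτ, hYL⟩ := ppm_perm Y Λ hY hΛ2 hcnt
    have hYeq : Y = trunc (fatR blk P) ((pmL σ : Matrix (Fin N) (Fin N) F) * Λ * (pmR τ : Matrix (Fin N) (Fin N) F)) := by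
      have : (pmL σ : Matrix (Fin N) (Fin N) F) * Λ * (pmR τ : Matrix (Fin N) (Fin N) F) = Y := by
        ext r s; rw [perm_mul, hYL]
      rw [this]
      symm
      apply trunc_self
      intro r s hrs
      rw [hYdef, trunc_ap, if_neg hrs]
    have m1 := LTm_mul hg' (LTm_perm (F := F) σ hσ)
    have m2 := LTm_mul (LTm_perm' (F := F) τ hτ) hh'
    refine ⟨_, _, m1.1, m2.1, m1.2, m2.2, ?_⟩
    rw [t2, hYeq, trunc_mul hU hD g' h' _ hg'.2 hh'.2]
    simp only [mul_assoc]

end orbits2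

section expo
variable {l : ℕ}

lemma s4_a (f : Fin l → Fin l → Fin l → Fin l → ℤ) :
    ∑ a, ∑ b, ∑ c, ∑ d, f a b c d = ∑ b, ∑ c, ∑ a, ∑ d, f a b c d := by
  rw [Finset.sum_comm]
  apply Finset.sum_congr rfl; intro b _
  rw [Finset.sum_comm]

lemma s4_b (f : Fin l → Fin l → Fin l → Fin l → ℤ) :
    ∑ a, ∑ b, ∑ c, ∑ d, f a b c d = ∑ b, ∑ d, ∑ a, ∑ c, f a b c d := by
  rw [Finset.sum_comm]
  apply Finset.sum_congr rfl; intro b _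
  symm
  rw [Finset.sum_comm]
  apply Finset.sum_congr rfl; intro a _
  rw [Finset.sum_comm]

lemma s4_c (f : Fin l → Fin l → Fin l → Fin l → ℤ) :
    ∑ a, ∑ b, ∑ c, ∑ d, f a b c d = ∑ a, ∑ c, ∑ b, ∑ d, f a b c d := by
  apply Finset.sum_congr rfl; intro b _
  rw [Finset.sum_comm]

lemma expo_sum (P : Fin l → Fin l → Prop) (hP : IsNormalChainSubposet P) (β : Fin l → ℕ)
    (lam mu : Fin l → Fin l → ℕ) (hl : ∀ i j, ¬ P i j → lam i j = 0) (hm : ∀ i j, ¬ P i j → mu i j = 0) :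
    ∑ p ∈ Finset.univ.filter (fun p : Fin l × Fin l => P p.1 p.2), expE β lam mu p.1 p.2 =
      (bDimL P β lam : ℤ) + bDimR P β lam - bNst P lam mu - bCrs P lam := by
  have E4 : ∀ f : Fin l → Fin l → ℤ, ∑ p ∈ Finset.univ.filter (fun p : Fin l × Fin l => P p.1 p.2), f p.1 p.2
      = ∑ i, ∑ j, if P i j then f i j else 0 := by
    intro f
    rw [Finset.sum_filter, Fintype.sum_prod_type]
  have t1 : ∑ p ∈ Finset.univ.filter (fun p : Fin l × Fin l => P p.1 p.2), (mu p.1 p.2 : ℤ) * Rl lam p.1 (p.2 + 1)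
      = bNst P lam mu := by
    rw [E4 (fun i j => (mu i j : ℤ) * Rl lam i (j + 1))]
    unfold bNst
    rw [Finset.sum_filter]
    push_cast
    simp only [Fintype.sum_prod_type]
    rw [s4_a]
    apply Finset.sum_congr rfl; intro i _
    apply Finset.sum_congr rfl; intro j _
    by_cases h : P i j
    · rw [if_pos h, Rl, Finset.mul_sum]
      apply Finset.sum_congr rfl; intro a _
      rw [Finset.mul_sum]
      apply Finset.sum_congr rfl; intro d _
      have : (j : ℕ) + 1 ≤ d ↔ j < d := by rw [Fin.lt_def]; omega
      by_cases h2 : P a d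
      · by_cases h3 : a < i <;> by_cases h4 : j < d <;> simp [this, h, h2, h3, h4, mul_comm]
      · simp [h2, hl a d h2]
    · simp [h]
  have t2 : ∑ p ∈ Finset.univ.filter (fun p : Fin l × Fin l => P p.1 p.2),
      (∑ k ∈ Finset.univ.filter (fun k => k < p.2), (mu p.1 k : ℤ)) *
       (∑ h ∈ Finset.univ.filter (fun h => h < p.1), (lam h p.2 : ℤ)) = bNst P lam mu := by
    rw [E4 (fun i j => (∑ k ∈ Finset.univ.filter (fun k => k < j), (mu i k : ℤ)) *
       (∑ h ∈ Finset.univ.filter (fun h => h < i), (lam h j : ℤ)))]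
    unfold bNst
    rw [Finset.sum_filter]
    push_cast
    simp only [Fintype.sum_prod_type]
    rw [s4_b]
    apply Finset.sum_congr rfl; intro i _
    apply Finset.sum_congr rfl; intro j _
    by_cases h : P i j
    · rw [if_pos h, mul_comm, Finset.sum_filter, Finset.sum_filter, Finset.sum_mul_sum]
      apply Finset.sum_congr rfl; intro a _
      apply Finset.sum_congr rfl; intro d _
      by_cases h2 : P a j
      · by_cases h5 : P i d
        · by_cases h3 : a < i <;> by_cases h4 : d < j <;> simp [h2, h3, h4, h5]
        · simp [h5, hm i d h5]
      · simp [h2, hl a j h2]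
    · rw [if_neg h]
      symm
      apply Finset.sum_eq_zero; intro a _
      apply Finset.sum_eq_zero; intro d _
      rw [if_neg]
      rintro ⟨h1, h2, h3, h4⟩
      exact h (hP.2.2 _ _ _ h4 h2)
  have t3 : ∑ p ∈ Finset.univ.filter (fun p : Fin l × Fin l => P p.1 p.2),
      (∑ k ∈ Finset.univ.filter (fun k => p.1 < k), (mu k p.2 : ℤ)) *
       (∑ m ∈ Finset.univ.filter (fun m => p.2 < m), (lam p.1 m : ℤ)) = bNst P lam mu := by
    rw [E4 (fun i j => (∑ k ∈ Finset.univ.filter (fun k => i < k), (mu k j : ℤ)) *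
       (∑ m ∈ Finset.univ.filter (fun m => j < m), (lam i m : ℤ)))]
    unfold bNst
    rw [Finset.sum_filter]
    push_cast
    simp only [Fintype.sum_prod_type]
    rw [s4_c]
    apply Finset.sum_congr rfl; intro i _
    apply Finset.sum_congr rfl; intro j _
    by_cases h : P i j
    · rw [if_pos h, Finset.sum_filter, Finset.sum_filter, Finset.sum_mul_sum]
      apply Finset.sum_congr rfl; intro b _
      apply Finset.sum_congr rfl; intro d _
      by_cases h2 : P b j
      · by_cases h5 : P i d
        · by_cases h3 : i < b <;> by_cases h4 : j < d <;> simp [h2, h3, h4, h5, mul_comm]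
        · simp [h5, hl i d h5]
      · simp [h2, hm b j h2]
    · rw [if_neg h]
      symm
      apply Finset.sum_eq_zero; intro a _
      apply Finset.sum_eq_zero; intro d _
      rw [if_neg]
      rintro ⟨h1, h2, h3, h4⟩
      exact h (hP.2.1 _ _ _ h4 h1)
  have t4 : ∑ p ∈ Finset.univ.filter (fun p : Fin l × Fin l => P p.1 p.2),
      (∑ m ∈ Finset.univ.filter (fun m => p.2 < m), (lam p.1 m : ℤ)) *
       (∑ h ∈ Finset.univ.filter (fun h => h < p.1), (lam h p.2 : ℤ)) = bCrs P lam := by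
    rw [E4 (fun i j => (∑ m ∈ Finset.univ.filter (fun m => j < m), (lam i m : ℤ)) *
       (∑ h ∈ Finset.univ.filter (fun h => h < i), (lam h j : ℤ)))]
    unfold bCrs
    rw [Finset.sum_filter]
    push_cast
    simp only [Fintype.sum_prod_type]
    rw [s4_a]
    apply Finset.sum_congr rfl; intro i _
    apply Finset.sum_congr rfl; intro j _
    by_cases h : P i j
    · rw [if_pos h, mul_comm, Finset.sum_filter, Finset.sum_filter, Finset.sum_mul_sum]
      apply Finset.sum_congr rfl; intro a _
      apply Finset.sum_congr rfl; intro d _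
      by_cases h2 : P a j
      · by_cases h5 : P i d
        · by_cases h3 : a < i <;> by_cases h4 : j < d <;> simp [h, h2, h3, h4, h5]
        · simp [h5, hl i d h5]
      · simp [h2, hl a j h2]
    · simp [h]
  have t5 : ∑ p ∈ Finset.univ.filter (fun p : Fin l × Fin l => P p.1 p.2),
      (β p.1 : ℤ) * (∑ h ∈ Finset.univ.filter (fun h => h < p.1), (lam h p.2 : ℤ)) = bDimR P β lam := by
    rw [E4 (fun i j => (β i : ℤ) * (∑ h ∈ Finset.univ.filter (fun h => h < i), (lam h j : ℤ)))]
    unfold bDimR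
    rw [Finset.sum_filter]
    push_cast
    simp only [Fintype.sum_prod_type]
    rw [Finset.sum_comm (s := (Finset.univ : Finset (Fin l))) (t := (Finset.univ : Finset (Fin l)))
      (f := fun a b => ∑ k, if a < b ∧ P b k ∧ P a k then (lam a k : ℤ) * β b else 0)]
    apply Finset.sum_congr rfl; intro i _
    rw [Finset.sum_comm]
    apply Finset.sum_congr rfl; intro j _
    by_cases h : P i j
    · rw [if_pos h, Finset.sum_filter, Finset.mul_sum]
      apply Finset.sum_congr rfl; intro a _
      by_cases h2 : P a j
      · by_cases h3 : a < i <;> simp [h, h2, h3, mul_comm]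
      · simp [h2, hl a j h2]
    · simp [h]
  have t6 : ∑ p ∈ Finset.univ.filter (fun p : Fin l × Fin l => P p.1 p.2),
      (β p.2 : ℤ) * (∑ m ∈ Finset.univ.filter (fun m => p.2 < m), (lam p.1 m : ℤ)) = bDimL P β lam := by
    rw [E4 (fun i j => (β j : ℤ) * (∑ m ∈ Finset.univ.filter (fun m => j < m), (lam i m : ℤ)))]
    unfold bDimL
    rw [Finset.sum_filter]
    push_cast
    simp only [Fintype.sum_prod_type]
    apply Finset.sum_congr rfl; intro i _
    apply Finset.sum_congr rfl; intro j _
    by_cases h : P i j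
    · rw [if_pos h, Finset.sum_filter, Finset.mul_sum]
      apply Finset.sum_congr rfl; intro m _
      by_cases h2 : P i m
      · by_cases h3 : j < m <;> simp [h, h2, h3, mul_comm]
      · simp [h2, hl i m h2]
    · simp [h]
  simp only [expE, sub_mul, Finset.sum_add_distrib, Finset.sum_sub_distrib, t1, t2, t3, t4, t5, t6]
  ring

end expo

/-- the general supercharacter formula
`χ^Λ(1+M) = q^{dim_L(λ)+dim_R(λ)−nst^λ_μ−crs(λ)} ∏_{i P j} S(r_{ij}, c_{ij}, λ(i,j), μ(i,j))`. -/
theorem stmt_14 (F : Type) [Field F] [Fintype F] (ψ : F → ℂ)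
    (hψadd : ∀ a b, ψ (a + b) = ψ a * ψ b) (hψ0 : ψ 0 = 1) (hψnt : ∃ a, ψ a ≠ 1)
    (N l : ℕ) (β : Fin l → ℕ) (blk : Fin N → Fin l)
    (hβ : ∀ i, 0 < β i) (hblk : Monotone blk)
    (hcard : ∀ i, (Finset.univ.filter fun r => blk r = i).card = β i)
    (P : Fin l → Fin l → Prop) (hP : IsNormalChainSubposet P)
    (G : ℕ → ℕ → ℕ)
    (hG1 : ∀ a k, k ≤ a →
      G a k * ∏ i ∈ Finset.range k, (Fintype.card F ^ (i + 1) - 1) =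
        ∏ i ∈ Finset.range k, (Fintype.card F ^ (a - k + i + 1) - 1))
    (hG2 : ∀ a k, a < k → G a k = 0)
    (lam mu : Fin l → Fin l → ℕ) (hlam : Tmem P β lam) (hmu : Tmem P β mu)
    (Λ M : Matrix (Fin N) (Fin N) F)
    (hΛ1 : Λ ∈ utAlg F (fatR blk P)) (hΛ2 : IsPPM Λ)
    (hΛ3 : ∀ i j, P i j → blockRank blk Λ i j = lam i j)
    (hM1 : M ∈ utAlg F (fatR blk P)) (hM2 : IsPPM M)
    (hM3 : ∀ i j, P i j → blockRank blk M i j = mu i j)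
    (hloc : ∀ i j, P i j → 0 ≤ locR β lam mu i j ∧ 0 ≤ locC β lam mu i j) :
    chi ψ blk (fatR blk P) Λ (1 + M) =
      (Fintype.card F : ℂ) ^ (bDimL P β lam + bDimR P β lam) /
          (Fintype.card F : ℂ) ^ (bNst P lam mu + bCrs P lam) *
        ∏ p ∈ Finset.univ.filter (fun p : Fin l × Fin l => P p.1 p.2),
          Sval F G (locR β lam mu p.1 p.2).toNat (locC β lam mu p.1 p.2).toNat
            (lam p.1 p.2) (mu p.1 p.2) := by
  obtain ⟨D, hDdef⟩ : ∃ D : Finset (Fin l × Fin l), D = Finset.univ.filter (fun p : Fin l × Fin l => P p.1 p.2) := ⟨_, rfl⟩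
  have hD : ∀ i j, (i, j) ∈ D ↔ P i j := by intro i j; rw [hDdef]; simp
  have hU : UpR D := by
    intro i i' j j' h hi hj
    rw [hD] at h ⊢
    have h1 : P i' j := by
      rcases hi.lt_or_eq with h' | h'
      · exact hP.2.1 _ _ _ h h'
      · subst h'; exact h
    rcases hj.lt_or_eq with h' | h'
    · exact hP.2.2 _ _ _ h1 h'
    · subst h'; exact h1
  have hl2 : ∀ i j, (ones blk Λ i j).card = lam i j := by
    intro i j
    by_cases h : P i j
    · rw [← blockRank_ppm _ hΛ2, hΛ3 i j h]
    · rw [hlam.1 i j h, Finset.card_eq_zero, ones, Finset.filter_eq_empty_iff]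
      rintro p _ ⟨h1, h2, h3⟩
      exact h3 (hΛ1 _ _ (by unfold fatR; rw [h1, h2]; exact h))
  let ψ' : AddChar F ℂ := ⟨ψ, hψ0, hψadd⟩
  have hψ' : ψ' ≠ 1 := by
    obtain ⟨a, ha⟩ := hψnt
    intro h
    apply ha
    have := DFunLike.congr_fun h a
    exact this.trans (AddChar.one_apply a)
  have hchi : chi ψ blk (fatR blk P) Λ (1 + M) = Wsum blk ψ' D Finset.univ Finset.univ (Rl lam) M := by
    unfold chi Wsum
    rw [finsum_mem_eq_finite_toFinset_sum _ (Set.toFinite _), ← Finset.sum_filter]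
    apply Finset.sum_congr
    · ext Z
      rw [Set.Finite.mem_toFinset, orb_iff hblk hU hD lam Λ hΛ1 hΛ2 hl2]
      simp
    · intro Z _
      rw [add_sub_cancel_left]
      rfl
  have hz : ∀ i j, (i, j) ∉ D → mu i j = 0 := fun i j h => hmu.1 i j (fun h' => h ((hD _ _).2 h'))
  rw [hchi, Wsum_main ψ' hψ' β lam mu _ D rfl hU _ _ M hM2]
  · rw [Finset.prod_mul_distrib]
    congr 1
    · have hq : (Fintype.card F : ℂ) ≠ 0 := by exact_mod_cast Fintype.card_ne_zero
      have hprod : ∀ (s : Finset (Fin l × Fin l)) (f : Fin l × Fin l → ℤ),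
          ∏ p ∈ s, (Fintype.card F : ℂ) ^ f p = (Fintype.card F : ℂ) ^ (∑ p ∈ s, f p) := by
        intro s f
        induction s using Finset.induction_on with
        | empty => simp
        | insert a s ha ih => rw [Finset.prod_insert ha, Finset.sum_insert ha, zpow_add₀ hq, ih]
      rw [hprod, hDdef, expo_sum P hP β lam mu hlam.1 hmu.1, ← zpow_natCast, ← zpow_natCast, ← zpow_sub₀ hq]
      congr 1
      push_cast
      ring
    · rw [hDdef]
      apply Finset.prod_congr rfl
      intro p _
      rw [Sval_eq F G hG1 hG2]
      congr 1 <;> omega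
  · intro r s h
    refine ⟨Finset.mem_univ _, Finset.mem_univ _, (hD _ _).2 ?_⟩
    by_contra hc
    exact h (hM1 _ _ hc)
  · intro i j h
    rw [← blockRank_ppm _ hM2, hM3 i j ((hD _ _).1 h)]
  · intro i
    rw [Finset.sum_eq_zero (fun k hk => hz _ _ (Finset.mem_filter.1 hk).2), add_zero, ← hcard i]
    unfold blkc
    congr!
  · intro i
    rw [Finset.sum_eq_zero (fun k hk => hz _ _ (Finset.mem_filter.1 hk).2), add_zero, ← hcard i]
    unfold blkc
    congr!


end
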